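/- arXiv:2604.14671 — 11 statements merged into one kernel-verified Lean document; each statement's English description precedes it below -/
import Mathlib

section
/- For all integers k ≥ 2 and q ≥ 2, one has M_{k,q} = α_loop(k,q), and moreover M_{k,q} ≤ α(k,q) ≤ M_{k,q} + q. -/
/-- The length-(k-1) suffix of `u` equals the length-(k-1) prefix of `v`. -/
def shifts (k q : ℕ) (u v : Fin k → Fin q) : Prop :=
  ∀ i : ℕ, (h : i + 1 < k) → u ⟨i + 1, h⟩ = v ⟨i, by omega⟩

/-- Adjacency in the simple graph underlying the de Bruijn graph B(k,q). -/
def dbAdj (k q : ℕ) (u v : Fin k → Fin q) : Prop :=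
  u ≠ v ∧ (shifts k q u v ∨ shifts k q v u)

/-- A finset of words is independent if no two of its elements are adjacent. -/
def IsIndep (k q : ℕ) (I : Finset (Fin k → Fin q)) : Prop :=
  ∀ u ∈ I, ∀ v ∈ I, ¬ dbAdj k q u v

/-- The independence number α(k,q) of the simple graph underlying B(k,q). -/
noncomputable def alphaDB (k q : ℕ) : ℕ :=
  sSup {n | ∃ I : Finset (Fin k → Fin q), IsIndep k q I ∧ I.card = n}

/-- The independence number α_loop(k,q): maximum size of an independent set
containing no constant word. -/
noncomputable def alphaLoop (k q : ℕ) : ℕ :=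
  sSup {n | ∃ I : Finset (Fin k → Fin q), IsIndep k q I ∧
    (∀ a : Fin q, (fun _ => a) ∉ I) ∧ I.card = n}

/-- The length-(k-1) prefix of a word of length k. -/
def wordPrefix {k q : ℕ} (x : Fin k → Fin q) : Fin (k - 1) → Fin q :=
  fun i => x ⟨i.val, by have := i.isLt; omega⟩

/-- The length-(k-1) suffix of a word of length k. -/
def wordSuffix {k q : ℕ} (x : Fin k → Fin q) : Fin (k - 1) → Fin q :=
  fun i => x ⟨i.val + 1, by have := i.isLt; omega⟩

/-- N_{k,q}(S): the number of words of length k whose prefix lies in S and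
whose suffix does not. -/
def Nword (k q : ℕ) (S : Finset (Fin (k - 1) → Fin q)) : ℕ :=
  (Finset.univ.filter (fun x : Fin k → Fin q =>
    wordPrefix x ∈ S ∧ wordSuffix x ∉ S)).card

/-- M_{k,q} := max over S ⊆ [q]^{k-1} of N_{k,q}(S). -/
def Mword (k q : ℕ) : ℕ :=
  Finset.univ.sup (fun S : Finset (Fin (k - 1) → Fin q) => Nword k q S)

theorem shifts_iff_wordSuffix_eq_wordPrefix {k q : ℕ} {u v : Fin k → Fin q} :
    shifts k q u v ↔ wordSuffix u = wordPrefix v := by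
  constructor
  · intro h
    funext i
    exact h i.val (by have := i.isLt; omega)
  · intro h i hi
    exact congrFun h ⟨i, by omega⟩

theorem eq_const_of_shifts_self {k q : ℕ} (hk : 0 < k) {x : Fin k → Fin q}
    (h : shifts k q x x) : x = fun _ => x ⟨0, hk⟩ := by
  have key : ∀ i : ℕ, ∀ hi : i < k, x ⟨i, hi⟩ = x ⟨0, hk⟩ := by
    intro i
    induction i with
    | zero => intro _; rfl
    | succ i ih => intro hi; exact (h i hi).trans (ih (by omega))
  funext i
  exact key i.val i.isLt

theorem IsIndep.mono {k q : ℕ} {I J : Finset (Fin k → Fin q)} (hI : IsIndep k q I)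
    (hJI : J ⊆ I) : IsIndep k q J :=
  fun u hu v hv => hI u (hJI hu) v (hJI hv)

theorem IsIndep.card_le_alphaDB {k q : ℕ} {I : Finset (Fin k → Fin q)}
    (hI : IsIndep k q I) : I.card ≤ alphaDB k q := by
  refine le_csSup ⟨Fintype.card (Fin k → Fin q), ?_⟩ ⟨I, hI, rfl⟩
  rintro n ⟨J, -, rfl⟩
  exact J.card_le_univ

theorem IsIndep.card_le_alphaLoop {k q : ℕ} {I : Finset (Fin k → Fin q)}
    (hI : IsIndep k q I) (hc : ∀ a : Fin q, (fun _ => a) ∉ I) : I.card ≤ alphaLoop k q := by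
  refine le_csSup ⟨Fintype.card (Fin k → Fin q), ?_⟩ ⟨I, hI, hc, rfl⟩
  rintro n ⟨J, -, -, rfl⟩
  exact J.card_le_univ

theorem isIndep_empty (k q : ℕ) : IsIndep k q ∅ := by
  simp [IsIndep]

theorem alphaLoop_le_alphaDB (k q : ℕ) : alphaLoop k q ≤ alphaDB k q := by
  refine csSup_le ⟨0, ∅, isIndep_empty k q, by simp, rfl⟩ ?_
  rintro n ⟨I, hI, -, rfl⟩
  exact hI.card_le_alphaDB

theorem alphaDB_le_alphaLoop_add (k q : ℕ) : alphaDB k q ≤ alphaLoop k q + q := by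
  refine csSup_le ⟨0, ∅, isIndep_empty k q, rfl⟩ ?_
  rintro n ⟨I, hI, rfl⟩
  let C : Finset (Fin k → Fin q) := Finset.univ.image fun a _ => a
  have hC : C.card ≤ q := Finset.card_image_le.trans (by simp)
  have hloop : (I \ C).card ≤ alphaLoop k q :=
    (hI.mono Finset.sdiff_subset).card_le_alphaLoop fun a ha =>
      (Finset.mem_sdiff.mp ha).2 (Finset.mem_image_of_mem _ (Finset.mem_univ a))
  have hsplit : I.card ≤ (I \ C).card + C.card := by
    have := Finset.le_card_sdiff C I
    omega
  omega

theorem Mword_le_alphaLoop (k q : ℕ) : Mword k q ≤ alphaLoop k q := by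
  refine Finset.sup_le fun S _ => IsIndep.card_le_alphaLoop ?_ ?_
  · rintro u hu v hv ⟨-, h | h⟩ <;>
      rw [shifts_iff_wordSuffix_eq_wordPrefix] at h <;>
      simp only [Finset.mem_filter, Finset.mem_univ, true_and] at hu hv
    · exact hu.2 (h ▸ hv.1)
    · exact hv.2 (h ▸ hu.1)
  · intro a ha
    simp only [Finset.mem_filter, Finset.mem_univ, true_and] at ha
    exact ha.2 ha.1

theorem alphaLoop_le_Mword {k : ℕ} (hk : 0 < k) (q : ℕ) : alphaLoop k q ≤ Mword k q := by
  refine csSup_le ⟨0, ∅, isIndep_empty k q, by simp, rfl⟩ ?_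
  rintro n ⟨I, hI, hc, rfl⟩
  refine le_trans (Finset.card_le_card fun x hx => ?_)
    (Finset.le_sup (f := Nword k q) (Finset.mem_univ (I.image wordPrefix)))
  simp only [Finset.mem_filter, Finset.mem_univ, true_and]
  refine ⟨Finset.mem_image_of_mem _ hx, fun h => ?_⟩
  obtain ⟨y, hy, hyx⟩ := Finset.mem_image.mp h
  have hxy : shifts k q x y := shifts_iff_wordSuffix_eq_wordPrefix.mpr hyx.symm
  by_cases hne : x = y
  · subst hne
    exact hc _ (eq_const_of_shifts_self hk hxy ▸ hx)
  · exact hI x hx y hy ⟨hne, Or.inl hxy⟩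

/-- M_{k,q} = α_loop(k,q) and M_{k,q} ≤ α(k,q) ≤ M_{k,q} + q. -/
theorem deBruijn_M_eq_alphaLoop_and_alpha_bounds (k q : ℕ) (hk : 2 ≤ k) (hq : 2 ≤ q) :
    Mword k q = alphaLoop k q ∧
    Mword k q ≤ alphaDB k q ∧ alphaDB k q ≤ Mword k q + q := by
  have hM : Mword k q = alphaLoop k q :=
    (Mword_le_alphaLoop k q).antisymm (alphaLoop_le_Mword (by omega) q)
  rw [hM]
  exact ⟨rfl, alphaLoop_le_alphaDB k q, alphaDB_le_alphaLoop_add k q⟩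
end

section
/- For all integers k ≥ 2, q ≥ 1 and every set S ⊆ [q]^{k−1}, let A_S ⊆ [0,1]^{k−1} be the union over (a_1,…,a_{k−1}) ∈ S of the q-adic cubes ∏_{j=1}^{k−1} [a_j/q, (a_j+1)/q). Then Φ_{k−1}(A_S) = N_{k,q}(S)/q^k. -/
open MeasureTheory

/-- The unit cube [0,1]^m. -/
def unitCube (m : ℕ) : Set (Fin m → ℝ) :=
  Set.univ.pi fun _ => Set.Icc (0 : ℝ) 1

/-- Φ_m(A) = ∫_{[0,1]^{m+1}} 1_A(x_1,…,x_m)(1 − 1_A(x_2,…,x_{m+1})) dx. -/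
noncomputable def Phi (m : ℕ) (A : Set (Fin m → ℝ)) : ℝ :=
  ∫ x : Fin (m + 1) → ℝ in unitCube (m + 1),
    (A.indicator (fun _ => (1 : ℝ)) (fun i : Fin m => x i.castSucc)) *
    (1 - A.indicator (fun _ => (1 : ℝ)) (fun i : Fin m => x i.succ))

/-- The union over (a_1,…,a_{k-1}) ∈ S of the q-adic cubes
∏_j [a_j/q, (a_j+1)/q). -/
def cubeSet (k q : ℕ) (S : Finset (Fin (k - 1) → Fin q)) : Set (Fin (k - 1) → ℝ) :=
  ⋃ a ∈ S, Set.univ.pi fun j => Set.Ico ((a j : ℝ) / q) (((a j : ℝ) + 1) / q)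

/-- The half-open `q`-adic cube with corner `a / q`. -/
def adicCube {m q : ℕ} (a : Fin m → Fin q) : Set (Fin m → ℝ) :=
  Set.univ.pi fun j => Set.Ico ((a j : ℝ) / q) (((a j : ℝ) + 1) / q)

theorem mem_adicCube_iff {m q : ℕ} (hq : 1 ≤ q) (a : Fin m → Fin q) (x : Fin m → ℝ) :
    x ∈ adicCube a ↔ ∀ j, (a j : ℝ) ≤ x j * q ∧ x j * q < (a j : ℝ) + 1 := by
  have hq' : (0 : ℝ) < q := by exact_mod_cast hq
  simp only [adicCube, Set.mem_univ_pi, Set.mem_Ico, div_le_iff₀ hq', lt_div_iff₀ hq']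

theorem eq_of_mem_adicCube {m q : ℕ} (hq : 1 ≤ q) {a b : Fin m → Fin q} {x : Fin m → ℝ}
    (ha : x ∈ adicCube a) (hb : x ∈ adicCube b) : a = b := by
  rw [mem_adicCube_iff hq] at ha hb
  ext j
  have h1 : ((a j : ℕ) : ℝ) < ((b j : ℕ) : ℝ) + 1 := (ha j).1.trans_lt (hb j).2
  have h2 : ((b j : ℕ) : ℝ) < ((a j : ℕ) : ℝ) + 1 := (hb j).1.trans_lt (ha j).2
  norm_cast at h1 h2
  omega

theorem measurableSet_adicCube {m q : ℕ} (a : Fin m → Fin q) : MeasurableSet (adicCube a) :=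
  MeasurableSet.univ_pi fun _ => measurableSet_Ico

theorem volume_real_adicCube {m q : ℕ} (a : Fin m → Fin q) :
    volume.real (adicCube a) = 1 / (q : ℝ) ^ m := by
  rw [Measure.real, adicCube, Real.volume_pi_Ico_toReal]
  · simp [← sub_div]
  · intro j
    dsimp only
    gcongr
    linarith

theorem volume_adicCube_ne_top {m q : ℕ} (a : Fin m → Fin q) : volume (adicCube a) ≠ ⊤ := by
  rw [adicCube, Real.volume_pi_Ico]
  exact ENNReal.prod_ne_top fun _ _ => ENNReal.ofReal_ne_top

theorem iUnion_adicCube {m q : ℕ} (hq : 1 ≤ q) :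
    ⋃ a : Fin m → Fin q, adicCube a = Set.univ.pi fun _ => Set.Ico (0 : ℝ) 1 := by
  have hq' : (0 : ℝ) < q := by exact_mod_cast hq
  ext x
  simp only [Set.mem_iUnion, mem_adicCube_iff hq, Set.mem_univ_pi, Set.mem_Ico]
  constructor
  · rintro ⟨a, ha⟩ j
    obtain ⟨h1, h2⟩ := ha j
    have h3 : ((a j : ℕ) : ℝ) + 1 ≤ q := by exact_mod_cast (a j).isLt
    constructor
    · exact nonneg_of_mul_nonneg_left ((Nat.cast_nonneg _).trans h1) hq'
    · exact lt_of_mul_lt_mul_right (by linarith) hq'.le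
  · intro hx
    have h0 : ∀ j, 0 ≤ x j * q := fun j => mul_nonneg (hx j).1 hq'.le
    refine ⟨fun j => ⟨⌊x j * q⌋₊, ?_⟩, fun j => ⟨Nat.floor_le (h0 j), Nat.lt_floor_add_one _⟩⟩
    rw [Nat.floor_lt (h0 j)]
    nlinarith [(hx j).2]

theorem mem_cubeSet_iff {k q : ℕ} (hq : 1 ≤ q) {S : Finset (Fin (k - 1) → Fin q)}
    {a : Fin (k - 1) → Fin q} {x : Fin (k - 1) → ℝ} (hx : x ∈ adicCube a) :
    x ∈ cubeSet k q S ↔ a ∈ S := by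
  simp only [cubeSet, Set.mem_iUnion, exists_prop]
  constructor
  · rintro ⟨b, hb, hxb⟩
    rwa [eq_of_mem_adicCube hq hx hxb]
  · exact fun ha => ⟨a, ha, hx⟩

theorem unitCube_ae_eq_iUnion_adicCube {m q : ℕ} (hq : 1 ≤ q) :
    unitCube m =ᵐ[volume] ⋃ a : Fin m → Fin q, adicCube a := by
  rw [iUnion_adicCube hq]
  exact Measure.pi_Ico_ae_eq_pi_Icc.symm

/-- Φ_{k-1}(A_S) = N_{k,q}(S)/q^k. -/
theorem Phi_cubeSet_eq_Nword_div (k q : ℕ) (hk : 2 ≤ k) (hq : 1 ≤ q)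
    (S : Finset (Fin (k - 1) → Fin q)) :
    Phi (k - 1) (cubeSet k q S) = (Nword k q S : ℝ) / q ^ k := by
  obtain ⟨m, rfl⟩ : ∃ m, k = m + 1 := ⟨k - 1, by omega⟩
  change Phi m (cubeSet (m + 1) q S) = _
  have heq : ∀ w : Fin (m + 1) → Fin q, Set.EqOn
      (fun x : Fin (m + 1) → ℝ =>
        ((cubeSet (m + 1) q S).indicator (fun _ => (1 : ℝ)) (fun i : Fin m => x i.castSucc)) *
        (1 - (cubeSet (m + 1) q S).indicator (fun _ => (1 : ℝ)) (fun i : Fin m => x i.succ)))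
      (fun _ => if wordPrefix w ∈ S ∧ wordSuffix w ∉ S then (1 : ℝ) else 0) (adicCube w) := by
    intro w x hx
    rw [adicCube, Set.mem_univ_pi] at hx
    have hp : (fun i : Fin m => x i.castSucc) ∈ cubeSet (m + 1) q S ↔ wordPrefix w ∈ S :=
      mem_cubeSet_iff hq (Set.mem_univ_pi.2 fun i => hx (Fin.castSucc i))
    have hs : (fun i : Fin m => x i.succ) ∈ cubeSet (m + 1) q S ↔ wordSuffix w ∈ S :=
      mem_cubeSet_iff hq (Set.mem_univ_pi.2 fun i => hx (Fin.succ i))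
    classical
    simp only [Set.indicator_apply]
    rw [if_congr hp rfl rfl, if_congr hs rfl rfl]
    by_cases h1 : wordPrefix w ∈ S <;> by_cases h2 : wordSuffix w ∈ S <;> simp [h1, h2]
  rw [Phi, setIntegral_congr_set (unitCube_ae_eq_iUnion_adicCube hq),
    integral_iUnion_fintype measurableSet_adicCube]
  · refine (Finset.sum_congr rfl fun w _ =>
      setIntegral_congr_fun (measurableSet_adicCube w) (heq w)).trans ?_
    simp_rw [setIntegral_const, volume_real_adicCube, smul_eq_mul, ← Finset.mul_sum,
      Finset.sum_boole]
    rw [Nword, one_div_mul_eq_div]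
  · intro a b hab
    exact Set.disjoint_left.2 fun x ha hb => hab (eq_of_mem_adicCube hq ha hb)
  · intro w
    exact (integrableOn_congr_fun (heq w) (measurableSet_adicCube w)).2
      (integrableOn_const (volume_adicCube_ne_top w))
end

section
/- For every fixed integer k ≥ 2, one has lim_{q→∞} M_{k,q}/q^k = λ_{k−1}, and consequently lim_{q→∞} α(k,q)/q^k = λ_{k−1} and lim_{q→∞} α_loop(k,q)/q^k = λ_{k−1}. -/
open MeasureTheory

/-- λ_m := sup of Φ_m(A) over measurable A ⊆ [0,1]^m. -/
noncomputable def lambdaTW (m : ℕ) : ℝ :=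
  sSup {r : ℝ | ∃ A : Set (Fin m → ℝ),
    MeasurableSet A ∧ A ⊆ unitCube m ∧ Phi m A = r}

namespace DeBruijn

open Filter ProbabilityTheory

/-- The uniform probability measure on `[0,1]`. -/
noncomputable def uniform01 : Measure ℝ := volume.restrict (Set.Icc 0 1)

instance : IsProbabilityMeasure uniform01 :=
  ⟨by simp [uniform01]⟩

theorem volume_restrict_unitCube (n : ℕ) :
    (volume : Measure (Fin n → ℝ)).restrict (unitCube n) = Measure.pi fun _ => uniform01 := by
  rw [unitCube, volume_pi, Measure.restrict_pi_pi]
  rfl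

/-- The points whose first `m` coordinates form a point of `A` while the last `m` do not. -/
def cut (m : ℕ) (A : Set (Fin m → ℝ)) : Set (Fin (m + 1) → ℝ) :=
  {x | (fun i : Fin m => x i.castSucc) ∈ A ∧ (fun i : Fin m => x i.succ) ∉ A}

theorem measurableSet_cut {m : ℕ} {A : Set (Fin m → ℝ)} (hA : MeasurableSet A) :
    MeasurableSet (cut m A) := by
  have h₁ : Measurable fun (x : Fin (m + 1) → ℝ) (i : Fin m) => x i.castSucc := by fun_prop
  have h₂ : Measurable fun (x : Fin (m + 1) → ℝ) (i : Fin m) => x i.succ := by fun_prop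
  exact (h₁ hA).inter (h₂ hA).compl

theorem Phi_eq_measureReal_cut {m : ℕ} {A : Set (Fin m → ℝ)} (hA : MeasurableSet A) :
    Phi m A = (Measure.pi fun _ : Fin (m + 1) => uniform01).real (cut m A) := by
  rw [← integral_indicator_one (measurableSet_cut hA), Phi, volume_restrict_unitCube]
  congr 1
  ext x
  by_cases h₁ : (fun i : Fin m => x i.castSucc) ∈ A <;>
    by_cases h₂ : (fun i : Fin m => x i.succ) ∈ A <;>
    simp [cut, h₁, h₂]

theorem bddAbove_Phi (m : ℕ) :
    BddAbove {r : ℝ | ∃ A : Set (Fin m → ℝ), MeasurableSet A ∧ A ⊆ unitCube m ∧ Phi m A = r} := by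
  refine ⟨1, ?_⟩
  rintro _ ⟨A, hA, -, rfl⟩
  rw [Phi_eq_measureReal_cut hA]
  exact measureReal_le_one

/-- The index of the interval `[a/q, (a+1)/q)` containing a point of `[0,1)`. -/
noncomputable def cell (q : ℕ) [NeZero q] (t : ℝ) : Fin q :=
  Fin.ofNat q ⌊(q : ℝ) * t⌋₊

theorem measurable_cell (q : ℕ) [NeZero q] : Measurable (cell q) :=
  (measurable_from_top (f := Fin.ofNat q)).comp
    (Nat.measurable_floor.comp (measurable_const.mul measurable_id))

theorem uniform01_cell (q : ℕ) [NeZero q] (a : Fin q) :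
    uniform01.real (cell q ⁻¹' {a}) = (q : ℝ)⁻¹ := by
  have hq : (0 : ℝ) < q := by exact_mod_cast Nat.pos_of_neZero q
  have ha : ((a : ℕ) : ℝ) + 1 ≤ q := by exact_mod_cast a.isLt
  rw [uniform01, ← restrict_Ico_eq_restrict_Icc,
    measureReal_restrict_apply (measurable_cell q (measurableSet_singleton a))]
  have : cell q ⁻¹' {a} ∩ Set.Ico 0 1 = Set.Ico ((a : ℕ) / (q : ℝ)) (((a : ℕ) + 1) / (q : ℝ)) := by
    ext t
    simp only [Set.mem_inter_iff, Set.mem_preimage, Set.mem_singleton_iff, Set.mem_Ico,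
      div_le_iff₀ hq, lt_div_iff₀ hq]
    constructor
    · rintro ⟨h, h0, h1⟩
      have hqt : 0 ≤ (q : ℝ) * t := by positivity
      have hlt : ⌊(q : ℝ) * t⌋₊ < q := by
        rw [Nat.floor_lt hqt]
        nlinarith
      have h' := congrArg Fin.val h
      simp only [cell, Fin.val_ofNat, Nat.mod_eq_of_lt hlt] at h'
      rw [Nat.floor_eq_iff hqt] at h'
      rwa [mul_comm t]
    · rintro ⟨h0, h1⟩
      rw [mul_comm] at h0 h1
      have hqt : 0 ≤ (q : ℝ) * t := le_trans (by positivity) h0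
      have h' := (Nat.floor_eq_iff hqt).2 ⟨h0, h1⟩
      refine ⟨?_, nonneg_of_mul_nonneg_right hqt hq, ?_⟩
      · ext
        simp [cell, h']
      · by_contra! h
        nlinarith
  rw [this, Real.volume_real_Ico_of_le (by gcongr; linarith)]
  ring

theorem pi_uniform01_cell {ι : Type*} [Fintype ι] (q : ℕ) [NeZero q] (w : ι → Fin q) :
    (Measure.pi fun _ : ι => uniform01).real ((fun x i => cell q (x i)) ⁻¹' {w}) =
      (q : ℝ)⁻¹ ^ Fintype.card ι := by
  have : (fun (x : ι → ℝ) i => cell q (x i)) ⁻¹' {w} =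
      Set.univ.pi fun i => cell q ⁻¹' {w i} := by
    ext x
    simp [funext_iff]
  rw [this, measureReal_def, Measure.pi_pi, ENNReal.toReal_prod]
  simp [← measureReal_def, uniform01_cell]

theorem Nword_div_pow_le_lambdaTW (m q : ℕ) [NeZero q] (S : Finset (Fin m → Fin q)) :
    (Nword (m + 1) q S : ℝ) / (q : ℝ) ^ (m + 1) ≤ lambdaTW m := by
  have hmeas (n : ℕ) : Measurable fun (x : Fin n → ℝ) i => cell q (x i) :=
    measurable_pi_lambda _ fun i => (measurable_cell q).comp (measurable_pi_apply i)
  set A : Set (Fin m → ℝ) := unitCube m ∩ (fun x i => cell q (x i)) ⁻¹' S with hAdef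
  have hcube (n : ℕ) : MeasurableSet (unitCube n) :=
    MeasurableSet.univ_pi fun _ => measurableSet_Icc
  have hA : MeasurableSet A := (hcube m).inter (hmeas m (Finset.measurableSet S))
  refine le_csSup (bddAbove_Phi m) ⟨A, hA, Set.inter_subset_left, ?_⟩
  rw [Phi_eq_measureReal_cut hA]
  set W := Finset.univ.filter fun x : Fin (m + 1) → Fin q => wordPrefix x ∈ S ∧ wordSuffix x ∉ S
  have hae : cut m A =ᵐ[Measure.pi fun _ => uniform01]
      (fun (x : Fin (m + 1) → ℝ) i => cell q (x i)) ⁻¹' (W : Set (Fin (m + 1) → Fin q)) := by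
    rw [← volume_restrict_unitCube]
    filter_upwards [ae_restrict_mem (hcube (m + 1))] with x hx
    have h₁ : (fun i : Fin m => x i.castSucc) ∈ unitCube m := fun i _ => hx _ trivial
    have h₂ : (fun i : Fin m => x i.succ) ∈ unitCube m := fun i _ => hx _ trivial
    apply propext
    change (_ ∈ A ∧ _ ∉ A) ↔ (fun i => cell q (x i)) ∈ (W : Set (Fin (m + 1) → Fin q))
    simp only [hAdef, Set.mem_inter_iff, h₁, h₂, true_and, W, Finset.coe_filter,
      Finset.mem_univ, Set.mem_ofPred_eq]
    rfl
  rw [measureReal_congr hae, ← sum_measureReal_preimage_singleton W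
    fun w _ => hmeas (m + 1) (measurableSet_singleton w)]
  simp only [pi_uniform01_cell, Finset.sum_const, Fintype.card_fin, nsmul_eq_mul, inv_pow]
  rfl

theorem measurePreserving_comp_embedding {ι κ : Type*} [Fintype ι] [Fintype κ] (x : ι ↪ κ) :
    MeasurePreserving (fun (t : κ → ℝ) i => t (x i))
      (Measure.pi fun _ : κ => uniform01) (Measure.pi fun _ : ι => uniform01) := by
  refine ⟨by fun_prop, ?_⟩
  have h := (iIndepFun_pi (μ := fun _ : κ => uniform01) (X := fun _ => id)
    fun _ => aemeasurable_id).precomp x.injective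
  refine ((iIndepFun_iff_map_fun_eq_pi_map
    fun i => (measurable_pi_apply (x i)).aemeasurable).1 h).trans ?_
  congr 1
  ext1 i
  exact (measurePreserving_eval (fun _ : κ => uniform01) (x i)).map_eq

theorem descFactorial_mul_Phi_le_Mword (m q : ℕ) {A : Set (Fin m → ℝ)} (hA : MeasurableSet A) :
    (q.descFactorial (m + 1) : ℝ) * Phi m A ≤ Mword (m + 1) q := by
  classical
  set P : Measure (Fin q → ℝ) := Measure.pi fun _ => uniform01
  set E : (Fin (m + 1) → Fin q) → Set (Fin q → ℝ) := fun x => (fun t i => t (x i)) ⁻¹' cut m A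
  have hE (x) : MeasurableSet (E x) := by
    have : Measurable fun (t : Fin q → ℝ) i => t (x i) := by fun_prop
    exact this (measurableSet_cut hA)
  have hint (x) : Integrable ((E x).indicator (1 : (Fin q → ℝ) → ℝ)) P :=
    (integrable_const 1).indicator (hE x)
  have hpt (t : Fin q → ℝ) :
      ∑ x, (E x).indicator (1 : (Fin q → ℝ) → ℝ) t ≤ Mword (m + 1) q := by
    let S : Finset (Fin m → Fin q) := Finset.univ.filter fun w => (fun i => t (w i)) ∈ A
    have hS : Nword (m + 1) q S ≤ Mword (m + 1) q :=
      Finset.le_sup (f := Nword (m + 1) q) (Finset.mem_univ S)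
    refine le_trans (le_of_eq ?_) (Nat.cast_le.2 hS)
    rw [Nword, Finset.card_filter]
    push_cast
    refine Finset.sum_congr rfl fun x _ => ?_
    rw [Set.indicator_apply]
    refine if_congr ?_ rfl rfl
    simp only [S, Finset.mem_filter, Finset.mem_univ, true_and]
    rfl
  calc (q.descFactorial (m + 1) : ℝ) * Phi m A
      = ∑ x : Fin (m + 1) ↪ Fin q, P.real (E x) := by
        have h (x : Fin (m + 1) ↪ Fin q) : P.real (E x) = Phi m A := by
          rw [Phi_eq_measureReal_cut hA]
          exact (measurePreserving_comp_embedding x).measureReal_preimage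
            (measurableSet_cut hA).nullMeasurableSet
        simp [h, Fintype.card_embedding_eq]
    _ ≤ ∑ x, P.real (E x) := by
        rw [← Finset.sum_image (s := Finset.univ) (f := fun x => P.real (E x))
          (g := fun x : Fin (m + 1) ↪ Fin q => (x : Fin (m + 1) → Fin q))
          DFunLike.coe_injective.injOn]
        exact Finset.sum_le_sum_of_subset_of_nonneg (Finset.subset_univ _)
          fun _ _ _ => measureReal_nonneg
    _ = ∫ t, ∑ x, (E x).indicator (1 : (Fin q → ℝ) → ℝ) t ∂P := by
        rw [integral_finsetSum _ fun x _ => hint x]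
        exact Finset.sum_congr rfl fun x _ => (integral_indicator_one (hE x)).symm
    _ ≤ ∫ _, (Mword (m + 1) q : ℝ) ∂P :=
        integral_mono (integrable_finsetSum _ fun x _ => hint x) (integrable_const _) hpt
    _ = Mword (m + 1) q := by simp [P]

theorem descFactorial_mul_lambdaTW_le_Mword (m q : ℕ) :
    (q.descFactorial (m + 1) : ℝ) * lambdaTW m ≤ Mword (m + 1) q := by
  rw [lambdaTW, ← smul_eq_mul, ← Real.sSup_smul_of_nonneg (Nat.cast_nonneg _)]
  refine Real.sSup_le ?_ (Nat.cast_nonneg _)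
  rintro _ ⟨_, ⟨A, hA, -, rfl⟩, rfl⟩
  exact descFactorial_mul_Phi_le_Mword m q hA

theorem Mword_div_pow_le_lambdaTW (m q : ℕ) [NeZero q] :
    (Mword (m + 1) q : ℝ) / (q : ℝ) ^ (m + 1) ≤ lambdaTW m := by
  obtain ⟨S, -, hS⟩ := Finset.exists_mem_eq_sup Finset.univ Finset.univ_nonempty
    (fun S : Finset (Fin (m + 1 - 1) → Fin q) => Nword (m + 1) q S)
  rw [Mword, hS]
  exact Nword_div_pow_le_lambdaTW m q S

theorem tendsto_Mword_div_pow (m : ℕ) :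
    Tendsto (fun q : ℕ => (Mword (m + 1) q : ℝ) / (q : ℝ) ^ (m + 1)) atTop
      (nhds (lambdaTW m)) := by
  have hlow : Tendsto (fun q : ℕ => (q.descFactorial (m + 1) : ℝ) / (q : ℝ) ^ (m + 1) * lambdaTW m)
      atTop (nhds (lambdaTW m)) := by
    have h : Tendsto (fun q : ℕ => (q.descFactorial (m + 1) : ℝ) / (q : ℝ) ^ (m + 1)) atTop
        (nhds 1) := by
      refine (Asymptotics.isEquivalent_iff_tendsto_one ?_).1 (isEquivalent_descFactorial (m + 1))
      filter_upwards [eventually_gt_atTop 0] with q hq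
      positivity
    simpa using h.mul_const (lambdaTW m)
  refine tendsto_of_tendsto_of_tendsto_of_le_of_le' hlow tendsto_const_nhds ?_ ?_
  · filter_upwards with q
    rw [div_mul_eq_mul_div]
    gcongr
    exact descFactorial_mul_lambdaTW_le_Mword m q
  · filter_upwards [eventually_gt_atTop 0] with q hq
    have : NeZero q := ⟨hq.ne'⟩
    exact Mword_div_pow_le_lambdaTW m q

theorem shifts_iff {k q : ℕ} (u v : Fin k → Fin q) :
    shifts k q u v ↔ wordSuffix u = wordPrefix v := by
  refine ⟨fun h => funext fun i => h i.val _, fun h i hi => ?_⟩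
  exact congrFun h ⟨i, by omega⟩

theorem eq_const_of_shifts_self {k q : ℕ} (hk : 0 < k) {u : Fin k → Fin q}
    (h : shifts k q u u) : u = fun _ => u ⟨0, hk⟩ := by
  funext ⟨i, hi⟩
  induction i with
  | zero => rfl
  | succ i ih => exact (h i hi).trans (ih (by omega))

theorem bddAbove_card {α : Type*} [Fintype α] (p : Finset α → Prop) :
    BddAbove {n | ∃ I : Finset α, p I ∧ I.card = n} := by
  refine ⟨Fintype.card α, ?_⟩
  rintro _ ⟨I, -, rfl⟩
  exact I.card_le_univ

theorem card_le_alphaLoop {k q : ℕ} {I : Finset (Fin k → Fin q)} (hI : IsIndep k q I)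
    (hc : ∀ a : Fin q, (fun _ => a) ∉ I) : I.card ≤ alphaLoop k q := by
  simp only [alphaLoop, ← and_assoc]
  exact le_csSup (bddAbove_card _) ⟨I, ⟨hI, hc⟩, rfl⟩

theorem Mword_le_alphaLoop (k q : ℕ) : Mword k q ≤ alphaLoop k q := by
  refine Finset.sup_le fun S _ => card_le_alphaLoop ?_ ?_
  · have key : ∀ u v : Fin k → Fin q, wordSuffix u ∉ S → wordPrefix v ∈ S → ¬ shifts k q u v :=
      fun u v hu hv h => hu ((shifts_iff u v).1 h ▸ hv)
    intro u hu v hv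
    simp only [Finset.mem_filter, Finset.mem_univ, true_and] at hu hv
    rintro ⟨-, h | h⟩
    · exact key u v hu.2 hv.1 h
    · exact key v u hv.2 hu.1 h
  · intro a ha
    simp only [Finset.mem_filter, Finset.mem_univ, true_and] at ha
    exact ha.2 ha.1

theorem alphaLoop_le_Mword {k : ℕ} (hk : 0 < k) (q : ℕ) : alphaLoop k q ≤ Mword k q := by
  classical
  refine csSup_le' ?_
  rintro _ ⟨I, hI, hc, rfl⟩
  refine le_trans (Finset.card_le_card fun u hu => ?_)
    (Finset.le_sup (f := Nword k q) (Finset.mem_univ (I.image wordPrefix)))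
  simp only [Finset.mem_filter, Finset.mem_univ, true_and, Finset.mem_image]
  refine ⟨⟨u, hu, rfl⟩, ?_⟩
  rintro ⟨v, hv, h⟩
  have hs : shifts k q u v := (shifts_iff u v).2 h.symm
  by_cases huv : u = v
  · subst huv
    exact hc _ (eq_const_of_shifts_self hk hs ▸ hu)
  · exact hI u hu v hv ⟨huv, Or.inl hs⟩

theorem alphaLoop_eq_Mword {k : ℕ} (hk : 0 < k) (q : ℕ) : alphaLoop k q = Mword k q :=
  (alphaLoop_le_Mword hk q).antisymm (Mword_le_alphaLoop k q)

theorem alphaLoop_le_alphaDB (k q : ℕ) : alphaLoop k q ≤ alphaDB k q := by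
  refine csSup_le' ?_
  rintro _ ⟨I, hI, -, rfl⟩
  exact le_csSup (bddAbove_card _) ⟨I, hI, rfl⟩

theorem alphaDB_le_alphaLoop_add (k q : ℕ) : alphaDB k q ≤ alphaLoop k q + q := by
  classical
  refine csSup_le' ?_
  rintro _ ⟨I, hI, rfl⟩
  set C : Finset (Fin k → Fin q) := Finset.univ.image fun a _ => a
  have hC : C.card ≤ q := Finset.card_image_le.trans (by simp)
  have hsub : (I \ C).card ≤ alphaLoop k q := by
    refine card_le_alphaLoop (fun u hu v hv => hI u ?_ v ?_) fun a ha => ?_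
    · exact (Finset.mem_sdiff.1 hu).1
    · exact (Finset.mem_sdiff.1 hv).1
    · exact (Finset.mem_sdiff.1 ha).2 (Finset.mem_image_of_mem _ (Finset.mem_univ a))
  have := Finset.card_le_card_sdiff_add_card (s := I) (t := C)
  omega

end DeBruijn

/-- for fixed k ≥ 2, M_{k,q}/q^k → λ_{k-1}, and consequently
α(k,q)/q^k → λ_{k-1} and α_loop(k,q)/q^k → λ_{k-1}, as q → ∞. -/
theorem tendsto_M_alpha_alphaLoop_div_q_pow (k : ℕ) (hk : 2 ≤ k) :
    Filter.Tendsto (fun q : ℕ => (Mword k q : ℝ) / (q : ℝ) ^ k)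
      Filter.atTop (nhds (lambdaTW (k - 1))) ∧
    Filter.Tendsto (fun q : ℕ => (alphaDB k q : ℝ) / (q : ℝ) ^ k)
      Filter.atTop (nhds (lambdaTW (k - 1))) ∧
    Filter.Tendsto (fun q : ℕ => (alphaLoop k q : ℝ) / (q : ℝ) ^ k)
      Filter.atTop (nhds (lambdaTW (k - 1))) := by
  obtain ⟨m, rfl⟩ : ∃ m, k = m + 1 := ⟨k - 1, by omega⟩
  rw [Nat.add_sub_cancel]
  have hM := DeBruijn.tendsto_Mword_div_pow m
  have hL : ∀ q, alphaLoop (m + 1) q = Mword (m + 1) q :=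
    DeBruijn.alphaLoop_eq_Mword m.succ_pos
  refine ⟨hM, ?_, by simpa only [hL] using hM⟩
  have hzero : Filter.Tendsto (fun q : ℕ => (q : ℝ) / (q : ℝ) ^ (m + 1)) Filter.atTop (nhds 0) := by
    have h := (tendsto_pow_neg_atTop (𝕜 := ℝ) (n := m) (by omega)).comp
      tendsto_natCast_atTop_atTop
    refine h.congr' ?_
    filter_upwards [Filter.eventually_gt_atTop 0] with q hq
    have : (q : ℝ) ≠ 0 := by positivity
    simp only [Function.comp_apply, zpow_neg, zpow_natCast]
    field_simp
    ring
  have hup := hM.add hzero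
  rw [add_zero] at hup
  refine tendsto_of_tendsto_of_tendsto_of_le_of_le hM hup (fun q => ?_) fun q => ?_
  · have : Mword (m + 1) q ≤ alphaDB (m + 1) q := hL q ▸ DeBruijn.alphaLoop_le_alphaDB _ _
    dsimp only
    gcongr
  · have : alphaDB (m + 1) q ≤ Mword (m + 1) q + q :=
      hL q ▸ DeBruijn.alphaDB_le_alphaLoop_add _ _
    dsimp only
    rw [← add_div]
    gcongr
    exact_mod_cast this
end

section
/- Let k ≥ 3 be an odd integer and q ≥ 2. For each divisor s of k, let η_s(q) := (1/s)·Σ_{d | s} μ(d)·q^{s/d}, where μ is the Möbius function. Then M_{k,q} ≤ (1/2)·Σ_{s | k} (s−1)·η_s(q). -/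
/-- η_s(q) := (1/s)·Σ_{d | s} μ(d)·q^{s/d}, the number of rotation orbits
of size s in [q]^k. -/
noncomputable def eta (s q : ℕ) : ℝ :=
  (1 / (s : ℝ)) * ∑ d ∈ s.divisors, (ArithmeticFunction.moebius d : ℝ) * (q : ℝ) ^ (s / d)

/-- Cyclic rotation of a word by one position. -/
def wordRotate {k q : ℕ} (x : Fin k → Fin q) : Fin k → Fin q :=
  fun i => x ⟨(i.val + 1) % k, Nat.mod_lt _ i.pos⟩

lemma wordRotate_iterate {k q : ℕ} (n : ℕ) (x : Fin k → Fin q) (i : Fin k) :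
    wordRotate^[n] x i = x ⟨(i.val + n) % k, Nat.mod_lt _ i.pos⟩ := by
  induction n generalizing x with
  | zero => simp [Nat.mod_eq_of_lt i.isLt]
  | succ n ih =>
    rw [Function.iterate_succ_apply, ih]
    simp [wordRotate, add_assoc]

lemma wordRotate_isPeriodicPt {k q : ℕ} (x : Fin k → Fin q) :
    Function.IsPeriodicPt wordRotate k x := by
  funext i
  simp [wordRotate_iterate, Nat.mod_eq_of_lt i.isLt]

lemma wordRotate_bijective (k q : ℕ) :
    Function.Bijective (wordRotate : (Fin k → Fin q) → Fin k → Fin q) := by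
  rw [← Finite.injective_iff_bijective]
  rcases k with _ | k
  · exact Function.injective_of_subsingleton _
  · intro x y h
    have hx := wordRotate_isPeriodicPt x
    have hy := wordRotate_isPeriodicPt y
    rw [← hx.eq, ← hy.eq, Function.iterate_succ_apply, Function.iterate_succ_apply, h]

lemma wordSuffix_eq_wordPrefix_wordRotate {k q : ℕ} (x : Fin k → Fin q) :
    wordSuffix x = wordPrefix (wordRotate x) := by
  funext i
  have hi : i.val + 1 < k := by have := i.isLt; omega
  simp [wordSuffix, wordPrefix, wordRotate, Nat.mod_eq_of_lt hi]

/-- A word fixed by rotation through a divisor `s` of its length is determined by its first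
`s` letters, which are arbitrary. -/
lemma card_isPeriodicPt_wordRotate {k s : ℕ} (q : ℕ) (hk : 0 < k) (hs : s ∣ k) :
    (Finset.univ.filter fun x : Fin k → Fin q => wordRotate^[s] x = x).card = q ^ s := by
  have hs0 : 0 < s := Nat.pos_of_dvd_of_pos hs hk
  have hsk : s ≤ k := Nat.le_of_dvd hk hs
  rw [← Fintype.card_subtype]
  let e : {x : Fin k → Fin q // wordRotate^[s] x = x} ≃ (Fin s → Fin q) :=
    { toFun := fun x j => x.1 ⟨j.val, j.isLt.trans_le hsk⟩
      invFun := fun y => ⟨fun i => y ⟨i.val % s, Nat.mod_lt _ hs0⟩, by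
        funext i
        simp [wordRotate_iterate, Nat.mod_mod_of_dvd _ hs]⟩
      left_inv := by
        rintro ⟨x, hx⟩
        ext1
        funext i
        have h : wordRotate^[s * (i.val / s)] x = x :=
          Function.IsPeriodicPt.mul_const (show Function.IsPeriodicPt wordRotate s x from hx) _
        have h' := congrFun h ⟨i.val % s, (Nat.mod_lt _ hs0).trans_le hsk⟩
        rw [wordRotate_iterate] at h'
        simpa [Nat.mod_add_div, Nat.mod_eq_of_lt i.isLt] using h'.symm
      right_inv := by
        intro y
        funext j
        simp [Nat.mod_eq_of_lt j.isLt] }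
  rw [Fintype.card_congr e]
  simp

/-- The number of words of length `k` whose rotation orbit has size `s` is `s * η_s(q)`. -/
lemma card_minimalPeriod_eq_mul_eta {k s : ℕ} (q : ℕ) (hk : 0 < k) (hs : s ∣ k) :
    ((Finset.univ.filter fun x : Fin k → Fin q =>
      Function.minimalPeriod wordRotate x = s).card : ℝ) = s * eta s q := by
  have hs0 : 0 < s := Nat.pos_of_dvd_of_pos hs hk
  have key := (ArithmeticFunction.sum_eq_iff_sum_mul_moebius_eq_on (R := ℝ)
    (f := fun s => ((Finset.univ.filter fun x : Fin k → Fin q =>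
      Function.minimalPeriod wordRotate x = s).card : ℝ))
    (g := fun s => (q : ℝ) ^ s) {n | n ∣ k} (fun m n hmn hn => hmn.trans hn)).1 ?_ s hs0 hs
  · rw [← key, eta, ← mul_assoc, mul_one_div_cancel (by positivity), one_mul,
      Nat.sum_divisorsAntidiagonal (fun i j => (ArithmeticFunction.moebius i : ℝ) * (q : ℝ) ^ j)]
  · intro n hn hnk
    have hcard := card_isPeriodicPt_wordRotate q hk hnk
    rw [Finset.card_eq_sum_card_fiberwise (f := Function.minimalPeriod wordRotate)
      (t := n.divisors)] at hcard
    · rw [← Nat.cast_pow, ← hcard, Nat.cast_sum]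
      refine Finset.sum_congr rfl fun d hd => ?_
      rw [Finset.filter_filter]
      congr 2
      ext x
      simp only [Finset.mem_filter, Finset.mem_univ, true_and]
      refine ⟨fun h => ⟨?_, h⟩, fun h => h.2⟩
      exact Function.isPeriodicPt_iff_minimalPeriod_dvd.2 (h ▸ Nat.dvd_of_mem_divisors hd)
    · intro x hx
      simp only [Finset.coe_filter, Finset.mem_univ, true_and, Set.mem_ofPred_eq] at hx
      simp only [Finset.mem_coe, Nat.mem_divisors]
      exact ⟨Function.IsPeriodicPt.minimalPeriod_dvd hx, hn.ne'⟩

/-- A periodic sequence of odd period `s` with values in `{0, 1}` and no two cyclically adjacent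
ones has at most `(s - 1) / 2` ones in a period. -/
lemma two_mul_sum_range_add_one_le {s : ℕ} (hs : Odd s) {D : ℕ → ℕ} (hD : Function.Periodic D s)
    (h : ∀ i, D i + D (i + 1) ≤ 1) : 2 * ∑ i ∈ Finset.range s, D i + 1 ≤ s := by
  have hshift : ∑ i ∈ Finset.range s, D (i + 1) = ∑ i ∈ Finset.range s, D i := by
    have h1 := Finset.sum_range_succ D s
    have h2 := Finset.sum_range_succ' D s
    have h3 : D s = D 0 := by simpa using hD 0
    omega
  have hle : ∑ i ∈ Finset.range s, (D i + D (i + 1)) ≤ s := by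
    simpa using Finset.sum_le_sum fun i (_ : i ∈ Finset.range s) => h i
  rw [Finset.sum_add_distrib, hshift] at hle
  obtain ⟨m, rfl⟩ := hs
  omega

lemma sum_range_mul_of_periodic {s : ℕ} {D : ℕ → ℕ} (hD : Function.Periodic D s) (m : ℕ) :
    ∑ i ∈ Finset.range (m * s), D i = m * ∑ i ∈ Finset.range s, D i := by
  induction m with
  | zero => simp
  | succ m ih =>
    rw [add_mul, one_mul, Finset.sum_range_add, ih, add_mul, one_mul]
    congr 1
    refine Finset.sum_congr rfl fun i _ => ?_
    rw [add_comm]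
    exact hD.nat_mul m i

/-- Among the rotations of a word with orbit size `s`, the proportion of those whose prefix lies
in `S` and whose suffix does not is at most `(s - 1) / (2 * s)`. -/
lemma sum_rotations_le {k q : ℕ} (hk : Odd k) (S : Finset (Fin (k - 1) → Fin q))
    (x : Fin k → Fin q) :
    ((∑ i ∈ Finset.range k, if wordPrefix (wordRotate^[i] x) ∈ S ∧
      wordSuffix (wordRotate^[i] x) ∉ S then 1 else 0 : ℕ) : ℝ) ≤
      k * ((1 / 2) * (((Function.minimalPeriod wordRotate x : ℝ) - 1) /
        Function.minimalPeriod wordRotate x)) := by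
  set s := Function.minimalPeriod wordRotate x with hs_def
  set D : ℕ → ℕ := fun i => if wordPrefix (wordRotate^[i] x) ∈ S ∧
      wordSuffix (wordRotate^[i] x) ∉ S then 1 else 0 with hD_def
  have hsk : s ∣ k := (wordRotate_isPeriodicPt x).minimalPeriod_dvd
  have hodd : Odd s := hk.of_dvd_nat hsk
  have hs0 : (0 : ℝ) < s := by exact_mod_cast hodd.pos
  have hper : Function.Periodic D s := fun i => by
    simp only [hD_def, hs_def, Function.iterate_add_apply, Function.iterate_minimalPeriod]
  have hadj : ∀ i, D i + D (i + 1) ≤ 1 := fun i => by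
    simp only [hD_def, wordSuffix_eq_wordPrefix_wordRotate, ← Function.iterate_succ_apply']
    split_ifs <;> first | omega | (exfalso; tauto)
  have hsum := two_mul_sum_range_add_one_le hodd hper hadj
  obtain ⟨m, hm⟩ := hsk
  have hkm : k = m * s := by rw [hm, mul_comm]
  have hsum' : (2 * ∑ i ∈ Finset.range s, D i + 1 : ℝ) ≤ s := by exact_mod_cast hsum
  have htotal : ∑ i ∈ Finset.range k, D i = m * ∑ i ∈ Finset.range s, D i := by
    rw [hkm, sum_range_mul_of_periodic hper]
  have hrhs : (k : ℝ) * ((1 / 2) * (((s : ℝ) - 1) / s)) = m * (((s : ℝ) - 1) / 2) := by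
    have : (k : ℝ) = m * s := by exact_mod_cast hkm
    rw [this]
    field_simp
  rw [hrhs, htotal]
  push_cast
  gcongr
  push_cast at hsum'
  linarith

lemma mul_Nword_eq_sum_rotations (k q : ℕ) (S : Finset (Fin (k - 1) → Fin q)) :
    k * Nword k q S = ∑ x : Fin k → Fin q, ∑ i ∈ Finset.range k,
      if wordPrefix (wordRotate^[i] x) ∈ S ∧ wordSuffix (wordRotate^[i] x) ∉ S then 1 else 0 := by
  rw [Finset.sum_comm, Nword, Finset.card_filter]
  have h (i : ℕ) := ((wordRotate_bijective k q).iterate i).sum_comp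
    fun x => if wordPrefix x ∈ S ∧ wordSuffix x ∉ S then 1 else 0
  simp [h]

lemma Nword_le_half_sum_eta {k : ℕ} (q : ℕ) (hk : Odd k) (S : Finset (Fin (k - 1) → Fin q)) :
    (Nword k q S : ℝ) ≤ (1 / 2) * ∑ s ∈ k.divisors, ((s : ℝ) - 1) * eta s q := by
  have hk0 : (0 : ℝ) < k := by exact_mod_cast hk.pos
  refine le_of_mul_le_mul_left ?_ hk0
  rw [← Nat.cast_mul, mul_Nword_eq_sum_rotations, Nat.cast_sum]
  refine (Finset.sum_le_sum fun x _ => sum_rotations_le hk S x).trans_eq ?_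
  rw [← Finset.mul_sum, ← Finset.mul_sum]
  congr 2
  have hmaps : ∀ x ∈ (Finset.univ : Finset (Fin k → Fin q)),
      Function.minimalPeriod wordRotate x ∈ k.divisors := fun x _ =>
    Nat.mem_divisors.2 ⟨(wordRotate_isPeriodicPt x).minimalPeriod_dvd, hk.pos.ne'⟩
  rw [← Finset.sum_fiberwise_of_maps_to' hmaps fun s : ℕ => ((s : ℝ) - 1) / s]
  refine Finset.sum_congr rfl fun s hs => ?_
  have hs0 : (s : ℝ) ≠ 0 := by exact_mod_cast (Nat.pos_of_mem_divisors hs).ne'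
  rw [Finset.sum_const, nsmul_eq_mul,
    card_minimalPeriod_eq_mul_eta q hk.pos (Nat.dvd_of_mem_divisors hs)]
  field_simp

/-- for odd k ≥ 3 and q ≥ 2,
M_{k,q} ≤ (1/2)·Σ_{s | k} (s−1)·η_s(q). -/
theorem Mword_le_half_sum_eta (k q : ℕ) (hk : 3 ≤ k) (hkodd : Odd k) (hq : 2 ≤ q) :
    (Mword k q : ℝ) ≤ (1 / 2) * ∑ s ∈ k.divisors, ((s : ℝ) - 1) * eta s q := by
  obtain ⟨S, -, hS⟩ := Finset.exists_mem_eq_sup Finset.univ Finset.univ_nonempty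
    (fun S : Finset (Fin (k - 1) → Fin q) => Nword k q S)
  rw [Mword, hS]
  exact Nword_le_half_sum_eta q hkodd S
end

section
/- If k is an odd prime and q ≥ 2, then M_{k,q} ≤ (k−1)(q^k − q)/(2k), and consequently α(k,q) ≤ (k−1)(q^k − q)/(2k) + q. -/
/-- Cyclic rotation of a word by `i` places. -/
def rotateWord {k q : ℕ} [NeZero k] (i : Fin k) : Equiv.Perm (Fin k → Fin q) :=
  (Equiv.addRight (-i)).arrowCongr (Equiv.refl _)

theorem rotateWord_apply {k q : ℕ} [NeZero k] (i j : Fin k) (x : Fin k → Fin q) :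
    rotateWord i x j = x (j + i) := by
  simp [rotateWord, Equiv.arrowCongr]

theorem rotateWord_rotateWord {k q : ℕ} [NeZero k] (i j : Fin k) (x : Fin k → Fin q) :
    rotateWord i (rotateWord j x) = rotateWord (j + i) x := by
  funext l
  simp only [rotateWord_apply]
  congr 1
  abel

theorem Fin.mk_add_one_eq {k : ℕ} [NeZero k] (i : ℕ) (h : i + 1 < k) :
    (⟨i, by omega⟩ : Fin k) + 1 = ⟨i + 1, h⟩ := by
  apply Fin.ext
  rw [Fin.val_add, Fin.val_one', Nat.mod_eq_of_lt (a := 1) (by omega)]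
  exact Nat.mod_eq_of_lt h

theorem shifts_rotateWord_one {k q : ℕ} [NeZero k] (x : Fin k → Fin q) :
    shifts k q x (rotateWord 1 x) := by
  intro i h
  rw [rotateWord_apply, Fin.mk_add_one_eq i h]

theorem wordPrefix_rotateWord_one {k q : ℕ} [NeZero k] (x : Fin k → Fin q) :
    wordPrefix (rotateWord 1 x) = wordSuffix x := by
  funext i
  exact (shifts_rotateWord_one x i (by have := i.isLt; omega)).symm

theorem rotateWord_one_eq_self_iff {k q : ℕ} [NeZero k] (x : Fin k → Fin q) :
    rotateWord 1 x = x ↔ ∃ a, x = Function.const _ a := by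
  constructor
  · intro h
    have hx : ∀ (i : ℕ) (hi : i < k), x ⟨i, hi⟩ = x 0 := by
      intro i
      induction i with
      | zero => intro _; rfl
      | succ i ih =>
        intro hi
        rw [shifts_rotateWord_one x i hi, h, ih]
    exact ⟨x 0, funext fun i => hx i i.isLt⟩
  · rintro ⟨a, rfl⟩
    funext i
    simp [rotateWord_apply]

theorem card_rotateWord_one_fixed {k q : ℕ} [NeZero k] :
    (Finset.univ.filter fun x : Fin k → Fin q => rotateWord 1 x = x).card = q := by
  have h : (Finset.univ.filter fun x : Fin k → Fin q => rotateWord 1 x = x) =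
      Finset.univ.image (Function.const (Fin k)) := by
    ext x
    simp only [rotateWord_one_eq_self_iff, Finset.mem_filter, Finset.mem_image, Finset.mem_univ,
      true_and]
    exact exists_congr fun a => eq_comm
  rw [h, Finset.card_image_of_injective _ Function.const_injective, Finset.card_univ,
    Fintype.card_fin]

/-- A set in an odd cycle with no two cyclically consecutive elements has at most `(k - 1) / 2`
elements. -/
theorem two_mul_card_le_of_add_one_notMem {k : ℕ} [NeZero k] (hk : Odd k) (B : Finset (Fin k))
    (hB : ∀ i ∈ B, i + 1 ∉ B) : 2 * B.card ≤ k - 1 := by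
  have hdisj : Disjoint B (B.map (Equiv.addRight 1).toEmbedding) := by
    rw [Finset.disjoint_right]
    intro i hi
    obtain ⟨j, hj, rfl⟩ := Finset.mem_map.1 hi
    exact hB j hj
  have h := Finset.card_le_univ (B ∪ B.map (Equiv.addRight 1).toEmbedding)
  rw [Finset.card_union_of_disjoint hdisj, Finset.card_map, Fintype.card_fin] at h
  obtain ⟨m, rfl⟩ := hk
  omega

theorem two_mul_mul_card_le_of_rotateWord_notMem {k q : ℕ} [NeZero k] (hk : Odd k)
    (T : Finset (Fin k → Fin q)) (hT : ∀ x ∈ T, rotateWord 1 x ∉ T) :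
    2 * k * T.card ≤ (k - 1) * (q ^ k - q) := by
  have hcard (i : Fin k) :
      (Finset.univ.filter fun x : Fin k → Fin q => rotateWord i x ∈ T).card = T.card := by
    rw [← Finset.card_map (rotateWord i).toEmbedding]
    congr 1
    ext x
    simp only [Finset.mem_map_equiv, Finset.mem_filter, Finset.mem_univ, true_and,
      Equiv.apply_symm_apply]
  have hdouble : ∑ x : Fin k → Fin q,
      (Finset.univ.filter fun i : Fin k => rotateWord i x ∈ T).card = k * T.card := by
    have h := Finset.sum_card_bipartiteAbove_eq_sum_card_bipartiteBelow
      (s := Finset.univ) (t := Finset.univ)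
      (fun (x : Fin k → Fin q) (i : Fin k) => rotateWord i x ∈ T)
    simp only [Finset.bipartiteAbove, Finset.bipartiteBelow, hcard] at h
    simpa using h
  have hbound (x : Fin k → Fin q) :
      2 * (Finset.univ.filter fun i : Fin k => rotateWord i x ∈ T).card ≤
        if rotateWord 1 x = x then 0 else k - 1 := by
    split_ifs with hx
    · obtain ⟨a, rfl⟩ := (rotateWord_one_eq_self_iff x).1 hx
      have hfix (i : Fin k) :
          rotateWord i (Function.const (Fin k) a) = Function.const (Fin k) a := by
        funext j
        simp [rotateWord_apply]
      have ha : Function.const (Fin k) a ∉ T := fun h => hT _ h (by rwa [hx])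
      simp [hfix, ha]
    · apply two_mul_card_le_of_add_one_notMem hk
      simp only [Finset.mem_filter, Finset.mem_univ, true_and]
      intro i hi
      rw [← rotateWord_rotateWord]
      exact hT _ hi
  have hnonfixed : (Finset.univ.filter fun x : Fin k → Fin q => ¬ rotateWord 1 x = x).card =
      q ^ k - q := by
    have h := Finset.card_filter_add_card_filter_not (s := Finset.univ)
      (fun x : Fin k → Fin q => rotateWord 1 x = x)
    rw [card_rotateWord_one_fixed, Finset.card_univ, Fintype.card_fun, Fintype.card_fin,
      Fintype.card_fin] at h
    omega
  calc 2 * k * T.card = ∑ x : Fin k → Fin q,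
        2 * (Finset.univ.filter fun i : Fin k => rotateWord i x ∈ T).card := by
        rw [← Finset.mul_sum, hdouble, mul_assoc]
    _ ≤ ∑ x : Fin k → Fin q, if rotateWord 1 x = x then 0 else k - 1 :=
        Finset.sum_le_sum fun x _ => hbound x
    _ = (k - 1) * (q ^ k - q) := by
        rw [Finset.sum_ite, Finset.sum_const_zero, zero_add, Finset.sum_const, hnonfixed,
          smul_eq_mul, mul_comm]

theorem card_le_of_rotateWord_notMem {k q : ℕ} [NeZero k] (hk : Odd k)
    (T : Finset (Fin k → Fin q)) (hT : ∀ x ∈ T, rotateWord 1 x ∉ T) :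
    (T.card : ℝ) ≤ ((k : ℝ) - 1) * ((q : ℝ) ^ k - q) / (2 * k) := by
  have h := two_mul_mul_card_le_of_rotateWord_notMem hk T hT
  have hk0 : 0 < k := Nat.pos_of_neZero k
  have h' : ((2 * k * T.card : ℕ) : ℝ) ≤ (((k - 1) * (q ^ k - q) : ℕ) : ℝ) := by
    exact_mod_cast h
  rw [Nat.cast_mul (k - 1), Nat.cast_sub hk0, Nat.cast_sub (Nat.le_self_pow hk0.ne' q)] at h'
  push_cast at h'
  rw [le_div_iff₀ (by positivity)]
  linarith

theorem Nword_le {k q : ℕ} (hk : Odd k) (S : Finset (Fin (k - 1) → Fin q)) :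
    (Nword k q S : ℝ) ≤ ((k : ℝ) - 1) * ((q : ℝ) ^ k - q) / (2 * k) := by
  have : NeZero k := ⟨hk.pos.ne'⟩
  apply card_le_of_rotateWord_notMem hk
  simp only [Finset.mem_filter, Finset.mem_univ, true_and, wordPrefix_rotateWord_one]
  exact fun x hx h => hx.2 h.1

theorem IsIndep.card_le {k q : ℕ} (hk : Odd k) {I : Finset (Fin k → Fin q)}
    (hI : IsIndep k q I) :
    (I.card : ℝ) ≤ ((k : ℝ) - 1) * ((q : ℝ) ^ k - q) / (2 * k) + q := by
  have : NeZero k := ⟨hk.pos.ne'⟩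
  have hT := card_le_of_rotateWord_notMem hk (I.filter fun x => ¬ rotateWord 1 x = x) (by
    simp only [Finset.mem_filter]
    exact fun x hx h => hI x hx.1 _ h.1 ⟨Ne.symm hx.2, Or.inl (shifts_rotateWord_one x)⟩)
  have hC : ((I.filter fun x => rotateWord 1 x = x).card : ℝ) ≤ q := by
    exact_mod_cast (Finset.card_le_card (Finset.filter_subset_filter _ I.subset_univ)).trans_eq
      card_rotateWord_one_fixed
  have hsum : ((I.filter fun x => rotateWord 1 x = x).card : ℝ) +
      (I.filter fun x => ¬ rotateWord 1 x = x).card = I.card := by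
    exact_mod_cast Finset.card_filter_add_card_filter_not (s := I) fun x => rotateWord 1 x = x
  linarith

/-- for an odd prime k and q ≥ 2, M_{k,q} ≤ (k−1)(q^k−q)/(2k)
and consequently α(k,q) ≤ (k−1)(q^k−q)/(2k) + q. -/
theorem Mword_alpha_upper_bound_odd_prime (k q : ℕ) (hk : k.Prime) (hkodd : Odd k)
    (hq : 2 ≤ q) :
    (Mword k q : ℝ) ≤ ((k : ℝ) - 1) * ((q : ℝ) ^ k - q) / (2 * k) ∧
    (alphaDB k q : ℝ) ≤ ((k : ℝ) - 1) * ((q : ℝ) ^ k - q) / (2 * k) + q := by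
  constructor
  · obtain ⟨S, -, hS⟩ := Finset.exists_mem_eq_sup Finset.univ Finset.univ_nonempty (Nword k q)
    rw [Mword, hS]
    exact Nword_le hkodd S
  · have hmem : alphaDB k q ∈ {n | ∃ I : Finset (Fin k → Fin q), IsIndep k q I ∧ I.card = n} :=
      Nat.sSup_mem ⟨0, ∅, by simp [IsIndep], rfl⟩
        ⟨_, by rintro _ ⟨I, -, rfl⟩; exact I.card_le_univ⟩
    obtain ⟨I, hI, hcard⟩ := hmem
    rw [← hcard]
    exact hI.card_le hkodd
end

section
/- For every function y : ℤ/7ℤ → {0,1}, one has Σ_{i ∈ ℤ/7ℤ} y_i·(1 − y_{i+1}) ≤ 1 + Σ_{i ∈ ℤ/7ℤ} y_i·(1 − y_{i+3}). -/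
/-- for every y : ℤ/7ℤ → {0,1},
Σ_i y_i·(1 − y_{i+1}) ≤ 1 + Σ_i y_i·(1 − y_{i+3}). -/
theorem seven_cycle_inequality (y : ZMod 7 → ℤ) (hy : ∀ i, y i = 0 ∨ y i = 1) :
    ∑ i : ZMod 7, y i * (1 - y (i + 1)) ≤ 1 + ∑ i : ZMod 7, y i * (1 - y (i + 3)) := by
  have sum_eq (f : ZMod 7 → ℤ) :
      ∑ i, f i = f 0 + f 1 + f 2 + f 3 + f 4 + f 5 + f 6 := Fin.sum_univ_seven f
  have cycle_bound : ∀ a ∈ ({0, 1} : Finset ℤ), ∀ b ∈ ({0, 1} : Finset ℤ),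
      ∀ c ∈ ({0, 1} : Finset ℤ), ∀ d ∈ ({0, 1} : Finset ℤ), ∀ e ∈ ({0, 1} : Finset ℤ),
      ∀ f ∈ ({0, 1} : Finset ℤ), ∀ g ∈ ({0, 1} : Finset ℤ),
      a * (1 - b) + b * (1 - c) + c * (1 - d) + d * (1 - e) + e * (1 - f) + f * (1 - g)
          + g * (1 - a) ≤
        1 + (a * (1 - d) + b * (1 - e) + c * (1 - f) + d * (1 - g) + e * (1 - a)
          + f * (1 - b) + g * (1 - c)) := by
    decide +kernel
  have mem (i : ZMod 7) : y i ∈ ({0, 1} : Finset ℤ) := by simpa using hy i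
  rw [sum_eq, sum_eq]
  exact cycle_bound _ (mem 0) _ (mem 1) _ (mem 2) _ (mem 3) _ (mem 4) _ (mem 5) _ (mem 6)
end

section
/- For every integer q ≥ 1 and every set S ⊆ [q]^3, one has 7·q^2·N_{4,q}(S) ≤ 7·|S|·(q^3 − |S|) + q^6, and consequently 28·N_{4,q}(S) ≤ 11·q^4. -/
/-- N_{4,q}(S): the number of quadruples (x₁,x₂,x₃,x₄) ∈ [q]⁴ with
(x₁,x₂,x₃) ∈ S and (x₂,x₃,x₄) ∉ S. -/
def N4 (q : ℕ) (S : Finset (Fin q × Fin q × Fin q)) : ℕ :=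
  (Finset.univ.filter (fun x : Fin q × Fin q × Fin q × Fin q =>
    (x.1, x.2.1, x.2.2.1) ∈ S ∧ (x.2.1, x.2.2.1, x.2.2.2) ∉ S)).card

theorem sum_fin_succ_arrow {α M : Type*} [Fintype α] [AddCommMonoid M] {n : ℕ}
    (F : (Fin (n + 1) → α) → M) :
    ∑ x, F x = ∑ a, ∑ y : Fin n → α, F (Fin.cons a y) := by
  rw [← (Fin.consEquiv fun _ => α).sum_comp, Fintype.sum_prod_type]
  rfl

/-- Sums over cyclic words are invariant under rotation. -/
theorem sum_rotate {α M : Type*} [Fintype α] [AddCommMonoid M] {n : ℕ} [NeZero n]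
    (i : Fin n) (F : (Fin n → α) → M) :
    ∑ x : Fin n → α, F (fun j => x (i + j)) = ∑ x, F x :=
  ((Equiv.addLeft i).symm.arrowCongr (Equiv.refl α)).sum_comp F

/-- On a cyclic binary word of length seven, the descents at distance one exceed the descents
at distance three by at most one. -/
theorem cyclic_descents_le (a : Fin 7 → Bool) :
    ∑ i, ((a i && !a (i + 1)).toNat : ℤ) ≤ ∑ i, ((a i && !a (i + 3)).toNat : ℤ) + 1 := by
  revert a
  decide +kernel

theorem sum_seven_adjacent {α : Type*} [Fintype α] (p : α → α → α → Bool) :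
    ∑ x : Fin 7 → α, ((p (x 0) (x 1) (x 2) && !p (x 1) (x 2) (x 3)).toNat : ℤ) =
      (Fintype.card α : ℤ) ^ 3 * ∑ a, ∑ b, ∑ c, ∑ d, ((p a b c && !p b c d).toNat : ℤ) := by
  simp only [sum_fin_succ_arrow]
  have h : ∀ (a b c d e f g : α) (y : Fin 0 → α),
      (let x : Fin 7 → α :=
        Fin.cons a (Fin.cons b (Fin.cons c (Fin.cons d (Fin.cons e (Fin.cons f (Fin.cons g y))))));
      ((p (x 0) (x 1) (x 2) && !p (x 1) (x 2) (x 3)).toNat : ℤ)) = (p a b c && !p b c d).toNat :=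
    fun _ _ _ _ _ _ _ _ => rfl
  simp only [h]
  simp only [Finset.sum_const, Finset.card_univ, Fintype.card_pi, Finset.univ_eq_empty,
    Finset.prod_empty, nsmul_eq_mul, ← Finset.mul_sum]
  push_cast
  ring

theorem sum_seven_disjoint {α : Type*} [Fintype α] (p : α → α → α → Bool) :
    ∑ x : Fin 7 → α, ((p (x 0) (x 1) (x 2) && !p (x 3) (x 4) (x 5)).toNat : ℤ) =
      Fintype.card α * ((∑ a, ∑ b, ∑ c, ((p a b c).toNat : ℤ)) *
        (Fintype.card α ^ 3 - ∑ a, ∑ b, ∑ c, ((p a b c).toNat : ℤ))) := by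
  simp only [sum_fin_succ_arrow]
  have h : ∀ (a b c d e f g : α) (y : Fin 0 → α),
      (let x : Fin 7 → α :=
        Fin.cons a (Fin.cons b (Fin.cons c (Fin.cons d (Fin.cons e (Fin.cons f (Fin.cons g y))))));
      ((p (x 0) (x 1) (x 2) && !p (x 3) (x 4) (x 5)).toNat : ℤ)) =
        (p a b c).toNat * (1 - (p d e f).toNat) := by
    intro a b c d e f g y
    change ((p a b c && !p d e f).toNat : ℤ) = _
    cases p a b c <;> cases p d e f <;> rfl
  simp only [h]
  simp only [Finset.sum_const, Finset.card_univ, Fintype.card_pi, Finset.univ_eq_empty,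
    Finset.prod_empty, nsmul_eq_mul, ← Finset.mul_sum, ← Finset.sum_mul,
    Finset.sum_sub_distrib]
  push_cast
  ring

/-- Averaging the bound on cyclic descents over all words of length seven. -/
theorem seven_mul_descents_le {α : Type*} [Fintype α] (p : α → α → α → Bool) :
    7 * ((Fintype.card α : ℤ) ^ 3 * ∑ a, ∑ b, ∑ c, ∑ d, ((p a b c && !p b c d).toNat : ℤ)) ≤
      7 * (Fintype.card α * ((∑ a, ∑ b, ∑ c, ((p a b c).toNat : ℤ)) *
        (Fintype.card α ^ 3 - ∑ a, ∑ b, ∑ c, ((p a b c).toNat : ℤ)))) +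
      (Fintype.card α : ℤ) ^ 7 := by
  have h := Finset.sum_le_sum fun (x : Fin 7 → α) (_ : x ∈ Finset.univ) =>
    cyclic_descents_le fun i => p (x (i + 0)) (x (i + 1)) (x (i + 2))
  rw [Finset.sum_add_distrib, Finset.sum_comm, Finset.sum_comm (s := Finset.univ (α := Fin 7 → α))]
    at h
  have h₁ : ∀ i : Fin 7, ∑ x : Fin 7 → α, ((p (x (i + 0)) (x (i + 1)) (x (i + 2)) &&
      !p (x (i + 1 + 0)) (x (i + 1 + 1)) (x (i + 1 + 2))).toNat : ℤ) =
      (Fintype.card α : ℤ) ^ 3 * ∑ a, ∑ b, ∑ c, ∑ d, ((p a b c && !p b c d).toNat : ℤ) := by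
    intro i
    rw [← sum_seven_adjacent, ← sum_rotate i fun x : Fin 7 → α =>
      ((p (x 0) (x 1) (x 2) && !p (x 1) (x 2) (x 3)).toNat : ℤ)]
    simp only [add_assoc]
    rfl
  have h₂ : ∀ i : Fin 7, ∑ x : Fin 7 → α, ((p (x (i + 0)) (x (i + 1)) (x (i + 2)) &&
      !p (x (i + 3 + 0)) (x (i + 3 + 1)) (x (i + 3 + 2))).toNat : ℤ) =
      Fintype.card α * ((∑ a, ∑ b, ∑ c, ((p a b c).toNat : ℤ)) *
        (Fintype.card α ^ 3 - ∑ a, ∑ b, ∑ c, ((p a b c).toNat : ℤ))) := by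
    intro i
    rw [← sum_seven_disjoint, ← sum_rotate i fun x : Fin 7 → α =>
      ((p (x 0) (x 1) (x 2) && !p (x 3) (x 4) (x 5)).toNat : ℤ)]
    simp only [add_assoc]
    rfl
  simp only [h₁, h₂] at h
  simpa using h

theorem N4_eq_sum (q : ℕ) (S : Finset (Fin q × Fin q × Fin q)) :
    (N4 q S : ℤ) = ∑ a, ∑ b, ∑ c, ∑ d,
      ((decide ((a, b, c) ∈ S) && !decide ((b, c, d) ∈ S)).toNat : ℤ) := by
  simp only [N4, Finset.card_filter, Fintype.sum_prod_type, Bool.toNat, Bool.cond_eq_ite,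
    Bool.and_eq_true, Bool.not_eq_true', decide_eq_true_eq, decide_eq_false_iff_not]
  push_cast
  rfl

theorem card_eq_sum_triples {α : Type*} [Fintype α] [DecidableEq α] (S : Finset (α × α × α)) :
    (S.card : ℤ) = ∑ a, ∑ b, ∑ c, ((decide ((a, b, c) ∈ S)).toNat : ℤ) := by
  have h : S.card = ∑ x, if x ∈ S then 1 else 0 := by simp
  rw [h]
  simp only [Fintype.sum_prod_type, Bool.toNat, Bool.cond_eq_ite, decide_eq_true_eq]
  push_cast
  rfl

/-- 7·q²·N_{4,q}(S) ≤ 7·|S|·(q³ − |S|) + q⁶, and consequently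
28·N_{4,q}(S) ≤ 11·q⁴. -/
theorem seven_cycle_discrete_upper_bound (q : ℕ) (hq : 1 ≤ q)
    (S : Finset (Fin q × Fin q × Fin q)) :
    7 * q ^ 2 * N4 q S ≤ 7 * S.card * (q ^ 3 - S.card) + q ^ 6 ∧
    28 * N4 q S ≤ 11 * q ^ 4 := by
  have hS : S.card ≤ q ^ 3 := by
    refine (Finset.card_le_univ S).trans_eq ?_
    simp only [Fintype.card_prod, Fintype.card_fin]
    ring
  have hq' : (0 : ℤ) < q := by exact_mod_cast hq
  have main : 7 * (q : ℤ) ^ 2 * N4 q S ≤ 7 * S.card * (q ^ 3 - S.card) + q ^ 6 := by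
    have h := seven_mul_descents_le fun a b c : Fin q => decide ((a, b, c) ∈ S)
    rw [← N4_eq_sum, ← card_eq_sum_triples, Fintype.card_fin] at h
    refine le_of_mul_le_mul_left ?_ hq'
    linarith
  constructor
  · zify [hS]
    exact main
  · zify
    refine le_of_mul_le_mul_left ?_ (pow_pos hq' 2)
    linarith [sq_nonneg ((q : ℤ) ^ 3 - 2 * S.card)]
end

section
/- For every Lebesgue-measurable set A ⊆ [0,1]^3, one has Φ_3(A) ≤ |A|·(1 − |A|) + 1/7, where |A| denotes the Lebesgue measure of A; consequently λ_3 ≤ 11/28. -/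
open MeasureTheory

/-- Lebesgue measure on the unit interval. -/
noncomputable def unitMeasure : Measure ℝ := volume.restrict (Set.Icc (0 : ℝ) 1)

instance isProbabilityMeasure_unitMeasure : IsProbabilityMeasure unitMeasure :=
  ⟨by simp [unitMeasure]⟩

theorem volume_restrict_unitCube (m : ℕ) :
    (volume : Measure (Fin m → ℝ)).restrict (unitCube m) = Measure.pi fun _ => unitMeasure := by
  simp only [unitCube, unitMeasure, volume_pi, Measure.restrict_pi_pi]

/-- Selecting distinct coordinates of a power of a probability measure preserves measure. -/
theorem measurePreserving_comp_injective {ι κ α : Type*} [Fintype ι] [Fintype κ]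
    [MeasurableSpace α] (μ : Measure α) [IsProbabilityMeasure μ] {e : κ → ι}
    (he : Function.Injective e) :
    MeasurePreserving (fun (x : ι → α) k => x (e k))
      (Measure.pi fun _ => μ) (Measure.pi fun _ => μ) := by
  refine ⟨by fun_prop, ?_⟩
  have h := (ProbabilityTheory.iIndepFun_pi (μ := fun _ : ι => μ)
    (X := fun _ (a : α) => a) (fun _ => aemeasurable_id)).precomp he
  rw [ProbabilityTheory.iIndepFun_iff_map_fun_eq_pi_map
    (fun k => (measurable_pi_apply (e k)).aemeasurable)] at h
  refine h.trans ?_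
  congr 1
  funext k
  exact (measurePreserving_eval (fun _ : ι => μ) (e k)).map_eq

/-- In a cyclic binary word of length seven, the pairs of ones at distance three
outnumber those at distance one by at most one. -/
theorem cyclic_seven_le {s : Fin 7 → ℝ} (hs : ∀ i, s i = 0 ∨ s i = 1) :
    ∑ i, s i * s (i + 3) ≤ ∑ i, s i * s (i + 1) + 1 := by
  have key : ∀ a b c d e f g : Bool,
      a.toNat * d.toNat + b.toNat * e.toNat + c.toNat * f.toNat + d.toNat * g.toNat + e.toNat * a.toNat +
          f.toNat * b.toNat + g.toNat * c.toNat ≤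
        a.toNat * b.toNat + b.toNat * c.toNat + c.toNat * d.toNat + d.toNat * e.toNat + e.toNat * f.toNat +
          f.toNat * g.toNat + g.toNat * a.toNat + 1 := by decide
  have hb : ∀ i, ∃ b : Bool, s i = (b.toNat : ℝ) := fun i => by
    rcases hs i with h | h
    · exact ⟨false, by simp [h]⟩
    · exact ⟨true, by simp [h]⟩
  choose b hb using hb
  have h := key (b 0) (b 1) (b 2) (b 3) (b 4) (b 5) (b 6)
  simp only [hb, Fin.sum_univ_seven]
  exact_mod_cast h

section Triples

variable {A : Set (Fin 3 → ℝ)}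

/-- The indicator of `A`, evaluated at three selected coordinates. -/
noncomputable def tripleIndicator {ι : Type*} (A : Set (Fin 3 → ℝ)) (t : Fin 3 → ι)
    (x : ι → ℝ) : ℝ :=
  A.indicator (fun _ => (1 : ℝ)) fun k => x (t k)

theorem measurable_tripleIndicator {ι : Type*} (hA : MeasurableSet A) (t : Fin 3 → ι) :
    Measurable (tripleIndicator A t) :=
  (measurable_const.indicator hA).comp (by fun_prop)

theorem tripleIndicator_eq_zero_or_one {ι : Type*} (t : Fin 3 → ι) (x : ι → ℝ) :
    tripleIndicator A t x = 0 ∨ tripleIndicator A t x = 1 :=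
  Set.indicator_eq_zero_or_self _ _ _

theorem integrable_tripleIndicator_mul {ι : Type*} [Fintype ι] (hA : MeasurableSet A)
    (t u : Fin 3 → ι) :
    Integrable (fun x => tripleIndicator A t x * tripleIndicator A u x)
      (Measure.pi fun _ => unitMeasure) := by
  refine Integrable.of_bound ((measurable_tripleIndicator hA t).mul
    (measurable_tripleIndicator hA u)).aestronglyMeasurable 1 (.of_forall fun x => ?_)
  rcases tripleIndicator_eq_zero_or_one (A := A) t x with h | h <;>
    rcases tripleIndicator_eq_zero_or_one (A := A) u x with h' | h' <;> simp [h, h']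

theorem integral_tripleIndicator_mul_comp {ι κ : Type*} [Fintype ι] [Fintype κ]
    (hA : MeasurableSet A) {e : κ → ι} (he : Function.Injective e) (t u : Fin 3 → κ) :
    ∫ x, tripleIndicator A (e ∘ t) x * tripleIndicator A (e ∘ u) x
        ∂(Measure.pi fun _ => unitMeasure) =
      ∫ y, tripleIndicator A t y * tripleIndicator A u y ∂(Measure.pi fun _ => unitMeasure) := by
  have h := measurePreserving_comp_injective unitMeasure he
  rw [← h.map_eq, integral_map h.measurable.aemeasurable (h.map_eq.symm ▸
    (integrable_tripleIndicator_mul hA t u).aestronglyMeasurable)]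
  rfl

theorem integral_indicator_unitMeasure (hA : MeasurableSet A) (hAc : A ⊆ unitCube 3) :
    ∫ y, A.indicator (fun _ => (1 : ℝ)) y ∂(Measure.pi fun _ => unitMeasure) =
      (volume A).toReal := by
  rw [integral_indicator_const _ hA, ← volume_restrict_unitCube, measureReal_def,
    Measure.restrict_apply hA, Set.inter_eq_left.2 hAc, smul_eq_mul, mul_one]

theorem integral_tripleIndicator {ι : Type*} [Fintype ι] (hA : MeasurableSet A)
    (hAc : A ⊆ unitCube 3) {t : Fin 3 → ι} (ht : Function.Injective t) :
    ∫ x, tripleIndicator A t x ∂(Measure.pi fun _ => unitMeasure) = (volume A).toReal := by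
  have h := measurePreserving_comp_injective unitMeasure ht
  rw [← integral_indicator_unitMeasure hA hAc, ← h.map_eq,
    integral_map h.measurable.aemeasurable
      (measurable_const.indicator hA).aestronglyMeasurable]
  rfl

theorem integral_tripleIndicator_mul_of_disjoint {ι : Type*} [Fintype ι] (hA : MeasurableSet A)
    (hAc : A ⊆ unitCube 3) {e : Fin 3 ⊕ Fin 3 → ι} (he : Function.Injective e) :
    ∫ x, tripleIndicator A (e ∘ Sum.inl) x * tripleIndicator A (e ∘ Sum.inr) x
        ∂(Measure.pi fun _ => unitMeasure) = (volume A).toReal ^ 2 := by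
  rw [integral_tripleIndicator_mul_comp hA he, sq, ← integral_indicator_unitMeasure hA hAc,
    ← integral_prod_mul]
  exact (measurePreserving_sumPiEquivProdPi fun _ : Fin 3 ⊕ Fin 3 => unitMeasure).integral_comp'
    fun p : (Fin 3 → ℝ) × (Fin 3 → ℝ) =>
      A.indicator (fun _ => (1 : ℝ)) p.1 * A.indicator (fun _ => (1 : ℝ)) p.2

theorem Phi_three_eq (hA : MeasurableSet A) (hAc : A ⊆ unitCube 3) :
    Phi 3 A = (volume A).toReal -
      ∫ x, tripleIndicator A (Fin.castSucc (n := 3)) x * tripleIndicator A Fin.succ x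
        ∂(Measure.pi fun _ => unitMeasure) := by
  have hI := integrable_tripleIndicator_mul hA (Fin.castSucc (n := 3)) Fin.castSucc
  have hsq : ∀ x, tripleIndicator A (Fin.castSucc (n := 3)) x *
      tripleIndicator A Fin.castSucc x = tripleIndicator A Fin.castSucc x := fun x => by
    rcases tripleIndicator_eq_zero_or_one (A := A) Fin.castSucc x with h | h <;> simp [h]
  simp only [hsq] at hI
  rw [Phi, volume_restrict_unitCube, ← integral_tripleIndicator hA hAc
    (Fin.castSucc_injective 3), ← integral_sub hI (integrable_tripleIndicator_mul hA _ _)]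
  exact integral_congr_ae (.of_forall fun x => mul_one_sub _ _)

theorem Phi_three_le (hA : MeasurableSet A) (hAc : A ⊆ unitCube 3) :
    Phi 3 A ≤ (volume A).toReal * (1 - (volume A).toReal) + 1 / 7 := by
  have near (i : Fin 7) := integral_tripleIndicator_mul_comp hA
    (e := fun k : Fin 4 => i + k.castLE (by norm_num)) (by revert i; decide)
    Fin.castSucc Fin.succ
  have far (i : Fin 7) := integral_tripleIndicator_mul_of_disjoint hA hAc
    (e := fun k : Fin 3 ⊕ Fin 3 => i + (finSumFinEquiv k).castLE (by norm_num))
    (by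
      intro j k h
      simpa using h)
  let F (i : Fin 7) := tripleIndicator A fun k : Fin 3 => i + k.castLE (by norm_num)
  have hint (d i : Fin 7) : Integrable (fun x => F i x * F (i + d) x)
      (Measure.pi fun _ => unitMeasure) := integrable_tripleIndicator_mul hA _ _
  have hle := integral_mono (integrable_finsetSum Finset.univ fun i _ => hint 3 i)
    ((integrable_finsetSum Finset.univ fun i _ => hint 1 i).add (integrable_const 1))
    fun x => cyclic_seven_le (s := fun i => F i x) fun i => tripleIndicator_eq_zero_or_one _ _
  have hnear (i : Fin 7) : ∫ x, F i x * F (i + 1) x ∂(Measure.pi fun _ => unitMeasure) =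
      (volume A).toReal - Phi 3 A := by
    have hi : (fun k : Fin 3 => i + 1 + k.castLE (by norm_num)) =
        (fun k : Fin 4 => i + k.castLE (by norm_num)) ∘ Fin.succ := by
      funext k
      revert i k
      decide
    rw [Phi_three_eq hA hAc, sub_sub_cancel, ← near i, ← hi]
    rfl
  have hfar (i : Fin 7) : ∫ x, F i x * F (i + 3) x ∂(Measure.pi fun _ => unitMeasure) =
      (volume A).toReal ^ 2 := by
    have hi : (fun k : Fin 3 => i + 3 + k.castLE (by norm_num)) =
        (fun k : Fin 3 ⊕ Fin 3 => i + (finSumFinEquiv k).castLE (by norm_num)) ∘ Sum.inr := by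
      funext k
      revert i k
      decide
    rw [← far i, ← hi]
    rfl
  simp only [Pi.add_apply] at hle
  rw [integral_add (integrable_finsetSum Finset.univ fun i _ => hint 1 i) (integrable_const 1),
    integral_finsetSum _ fun i _ => hint 3 i, integral_finsetSum _ fun i _ => hint 1 i] at hle
  simp only [hnear, hfar, Finset.sum_const, Finset.card_univ, Fintype.card_fin, nsmul_eq_mul,
    integral_const, probReal_univ, smul_eq_mul] at hle
  push_cast at hle
  linarith

end Triples

/-- for every measurable A ⊆ [0,1]³,
Φ₃(A) ≤ |A|·(1 − |A|) + 1/7; consequently λ₃ ≤ 11/28. -/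
theorem Phi_three_le_and_lambda_three_le (A : Set (Fin 3 → ℝ))
    (hA : MeasurableSet A) (hAc : A ⊆ unitCube 3) :
    (Phi 3 A ≤ (volume A).toReal * (1 - (volume A).toReal) + 1 / 7) ∧
    lambdaTW 3 ≤ 11 / 28 := by
  refine ⟨Phi_three_le hA hAc, Real.sSup_le ?_ (by norm_num)⟩
  rintro _ ⟨B, hB, hBc, rfl⟩
  linarith [Phi_three_le hB hBc, sq_nonneg ((volume B).toReal - 1 / 2)]
end

section
/- Let q ≥ 1, let S ⊆ [q]^3, and let a,b ∈ [q] with a ≠ b be such that H_q(a,b;S) holds. Let X := L_q(S) ⊆ [2q]^3 and let T := (X ∪ {P_1,P_2,P_3}) \ {M_1,M_2,M_3,M_4}, where P_1 = (2b,2b,2b+1), P_2 = (2b+1,2b,2b+1), P_3 = (2b+1,2a+1,2a), M_1 = (2a+1,2a,2a), M_2 = (2a+1,2a,2a+1), M_3 = (2b,2b+1,2a), M_4 = (2b,2b+1,2a+1). Then N_{4,2q}(T) = 16·N_{4,q}(S) + 1. -/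
/-- I_S(u,v) := #{x ∈ [q] : (x,u,v) ∈ S}. -/
def Ideg (q : ℕ) (S : Finset (Fin q × Fin q × Fin q)) (u v : Fin q) : ℕ :=
  (Finset.univ.filter (fun x : Fin q => (x, u, v) ∈ S)).card

/-- O_S(u,v) := #{c ∈ [q] : (u,v,c) ∈ S}. -/
def Odeg (q : ℕ) (S : Finset (Fin q × Fin q × Fin q)) (u v : Fin q) : ℕ :=
  (Finset.univ.filter (fun c : Fin q => (u, v, c) ∈ S)).card

/-- The local hypothesis H_q(a,b;S). -/
def Hq (q : ℕ) (a b : Fin q) (S : Finset (Fin q × Fin q × Fin q)) : Prop :=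
  (a, a, a) ∈ S ∧ (b, b, a) ∈ S ∧ (b, a, a) ∉ S ∧ (b, b, b) ∉ S ∧
  Ideg q S a a + Odeg q S a a = q ∧
  Ideg q S b b + Odeg q S b b = q ∧
  Ideg q S b b + Odeg q S b a = q - 1 ∧
  Ideg q S b a + Odeg q S a a = q + 1

/-- Halving map [2q] → [q], r ↦ ⌊r/2⌋. -/
def halfFin {q : ℕ} (x : Fin (2 * q)) : Fin q :=
  ⟨x.val / 2, by have := x.isLt; omega⟩

/-- The dyadic lift L_q(S) ⊆ [2q]³. -/
def lift4 (q : ℕ) (S : Finset (Fin q × Fin q × Fin q)) :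
    Finset (Fin (2 * q) × Fin (2 * q) × Fin (2 * q)) :=
  Finset.univ.filter (fun x => (halfFin x.1, halfFin x.2.1, halfFin x.2.2) ∈ S)

/-- The element 2a of [2q]. -/
def dbl0 {q : ℕ} (a : Fin q) : Fin (2 * q) := ⟨2 * a.val, by have := a.isLt; omega⟩

/-- The element 2a+1 of [2q]. -/
def dbl1 {q : ℕ} (a : Fin q) : Fin (2 * q) := ⟨2 * a.val + 1, by have := a.isLt; omega⟩

/-- The seven-site gadget modification T of the dyadic lift of S:
add P₁=(2b,2b,2b+1), P₂=(2b+1,2b,2b+1), P₃=(2b+1,2a+1,2a) and remove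
M₁=(2a+1,2a,2a), M₂=(2a+1,2a,2a+1), M₃=(2b,2b+1,2a), M₄=(2b,2b+1,2a+1). -/
def gadget (q : ℕ) (a b : Fin q) (S : Finset (Fin q × Fin q × Fin q)) :
    Finset (Fin (2 * q) × Fin (2 * q) × Fin (2 * q)) :=
  (lift4 q S ∪
      {(dbl0 b, dbl0 b, dbl1 b), (dbl1 b, dbl0 b, dbl1 b), (dbl1 b, dbl1 a, dbl0 a)}) \
    {(dbl1 a, dbl0 a, dbl0 a), (dbl1 a, dbl0 a, dbl1 a),
      (dbl0 b, dbl1 b, dbl0 a), (dbl0 b, dbl1 b, dbl1 a)}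

section DyadicHalving

variable {q : ℕ}

@[simp] theorem halfFin_dbl0 (a : Fin q) : halfFin (dbl0 a) = a := by
  ext; simp [halfFin, dbl0]

@[simp] theorem halfFin_dbl1 (a : Fin q) : halfFin (dbl1 a) = a := by
  ext; simp only [halfFin, dbl1]; omega

@[simp] theorem dbl0_inj {a b : Fin q} : dbl0 a = dbl0 b ↔ a = b := by
  simp [dbl0, Fin.ext_iff]

@[simp] theorem dbl1_inj {a b : Fin q} : dbl1 a = dbl1 b ↔ a = b := by
  simp [dbl1, Fin.ext_iff]

@[simp] theorem dbl0_ne_dbl1 (a b : Fin q) : dbl0 a ≠ dbl1 b := by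
  simp only [dbl0, dbl1, ne_eq, Fin.ext_iff]; omega

@[simp] theorem dbl1_ne_dbl0 (a b : Fin q) : dbl1 a ≠ dbl0 b :=
  (dbl0_ne_dbl1 b a).symm

theorem filter_halfFin_eq (a : Fin q) :
    Finset.univ.filter (fun x => halfFin x = a) = {dbl0 a, dbl1 a} := by
  ext x
  simp only [Finset.mem_filter, Finset.mem_univ, true_and, Finset.mem_insert,
    Finset.mem_singleton, halfFin, dbl0, dbl1, Fin.ext_iff]
  omega

theorem sum_comp_halfFin (g : Fin q → ℤ) : ∑ x, g (halfFin x) = 2 * ∑ i, g i := by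
  rw [← Finset.sum_fiberwise Finset.univ halfFin, Finset.mul_sum]
  refine Finset.sum_congr rfl fun i _ => ?_
  rw [filter_halfFin_eq, Finset.sum_pair (dbl0_ne_dbl1 i i)]
  simp [two_mul]

end DyadicHalving

/-- The integer-valued indicator of membership in `S`. -/
def tripleInd {n : ℕ} (S : Finset (Fin n × Fin n × Fin n)) (x y z : Fin n) : ℤ :=
  if (x, y, z) ∈ S then 1 else 0

section Indicator

variable {n : ℕ}

theorem Ideg_eq_sum (S : Finset (Fin n × Fin n × Fin n)) (y z : Fin n) :
    (Ideg n S y z : ℤ) = ∑ x, tripleInd S x y z := by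
  simp [Ideg, tripleInd]

theorem Odeg_eq_sum (S : Finset (Fin n × Fin n × Fin n)) (x y : Fin n) :
    (Odeg n S x y : ℤ) = ∑ z, tripleInd S x y z := by
  simp [Odeg, tripleInd]

theorem N4_eq_sum_s12 (S : Finset (Fin n × Fin n × Fin n)) :
    (N4 n S : ℤ) = ∑ y, ∑ z, (Ideg n S y z : ℤ) * (n - Odeg n S y z) := by
  have h : (N4 n S : ℤ) =
      ∑ x, ∑ y, ∑ z, ∑ w, tripleInd S x y z * (1 - tripleInd S y z w) := by
    rw [N4, Finset.card_filter]
    push_cast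
    simp only [Fintype.sum_prod_type]
    refine Finset.sum_congr rfl fun x _ => Finset.sum_congr rfl fun y _ =>
      Finset.sum_congr rfl fun z _ => Finset.sum_congr rfl fun w _ => ?_
    by_cases h₁ : (x, y, z) ∈ S <;> by_cases h₂ : (y, z, w) ∈ S <;>
      simp [tripleInd, h₁, h₂]
  rw [h, Finset.sum_comm]
  refine Finset.sum_congr rfl fun y _ => ?_
  rw [Finset.sum_comm]
  refine Finset.sum_congr rfl fun z _ => ?_
  rw [Ideg_eq_sum, Odeg_eq_sum, Finset.sum_mul]
  refine Finset.sum_congr rfl fun x _ => ?_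
  rw [← Finset.mul_sum]
  simp

theorem tripleInd_union_sdiff {X P M : Finset (Fin n × Fin n × Fin n)}
    (hP : Disjoint P X) (hM : M ⊆ X) (x y z : Fin n) :
    tripleInd ((X ∪ P) \ M) x y z =
      tripleInd X x y z + tripleInd P x y z - tripleInd M x y z := by
  have h₁ : (x, y, z) ∈ P → (x, y, z) ∉ X := fun h => Finset.disjoint_left.1 hP h
  have h₂ : (x, y, z) ∈ M → (x, y, z) ∈ X := fun h => hM h
  by_cases hx : (x, y, z) ∈ X <;> by_cases hp : (x, y, z) ∈ P <;>
    by_cases hm : (x, y, z) ∈ M <;> simp_all [tripleInd]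

theorem Ideg_union_sdiff {X P M : Finset (Fin n × Fin n × Fin n)}
    (hP : Disjoint P X) (hM : M ⊆ X) (y z : Fin n) :
    (Ideg n ((X ∪ P) \ M) y z : ℤ) = Ideg n X y z + (Ideg n P y z - Ideg n M y z) := by
  simp only [Ideg_eq_sum, tripleInd_union_sdiff hP hM, Finset.sum_add_distrib,
    Finset.sum_sub_distrib]
  ring

theorem Odeg_union_sdiff {X P M : Finset (Fin n × Fin n × Fin n)}
    (hP : Disjoint P X) (hM : M ⊆ X) (x y : Fin n) :
    (Odeg n ((X ∪ P) \ M) x y : ℤ) = Odeg n X x y + (Odeg n P x y - Odeg n M x y) := by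
  simp only [Odeg_eq_sum, tripleInd_union_sdiff hP hM, Finset.sum_add_distrib,
    Finset.sum_sub_distrib]
  ring

theorem sum_triple_mem (P : Finset (Fin n × Fin n × Fin n))
    (f : Fin n × Fin n × Fin n → ℤ) :
    ∑ p ∈ P, f p = ∑ x, ∑ y, ∑ z, tripleInd P x y z * f (x, y, z) := by
  have h : ∑ p ∈ P, f p = ∑ p, tripleInd P p.1 p.2.1 p.2.2 * f p := by
    simp [tripleInd]
  rw [h]
  simp only [Fintype.sum_prod_type]

theorem sum_Ideg_mul (P : Finset (Fin n × Fin n × Fin n)) (g : Fin n → Fin n → ℤ) :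
    ∑ y, ∑ z, (Ideg n P y z : ℤ) * g y z = ∑ p ∈ P, g p.2.1 p.2.2 := by
  rw [sum_triple_mem P]
  conv_rhs => rw [Finset.sum_comm]
  simp only [Ideg_eq_sum, Finset.sum_mul]
  exact Finset.sum_congr rfl fun y _ => Finset.sum_comm

theorem sum_Odeg_mul (P : Finset (Fin n × Fin n × Fin n)) (g : Fin n → Fin n → ℤ) :
    ∑ x, ∑ y, (Odeg n P x y : ℤ) * g x y = ∑ p ∈ P, g p.1 p.2.1 := by
  rw [sum_triple_mem P]
  simp only [Odeg_eq_sum, Finset.sum_mul]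

end Indicator

section Lift

variable {q : ℕ} (S : Finset (Fin q × Fin q × Fin q))

theorem tripleInd_lift4 (x y z : Fin (2 * q)) :
    tripleInd (lift4 q S) x y z = tripleInd S (halfFin x) (halfFin y) (halfFin z) := by
  simp [tripleInd, lift4]

theorem Ideg_lift4 (y z : Fin (2 * q)) :
    (Ideg (2 * q) (lift4 q S) y z : ℤ) = 2 * Ideg q S (halfFin y) (halfFin z) := by
  simp only [Ideg_eq_sum, tripleInd_lift4]
  exact sum_comp_halfFin fun i => tripleInd S i (halfFin y) (halfFin z)

theorem Odeg_lift4 (x y : Fin (2 * q)) :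
    (Odeg (2 * q) (lift4 q S) x y : ℤ) = 2 * Odeg q S (halfFin x) (halfFin y) := by
  simp only [Odeg_eq_sum, tripleInd_lift4]
  exact sum_comp_halfFin fun i => tripleInd S (halfFin x) (halfFin y) i

theorem N4_lift4 : (N4 (2 * q) (lift4 q S) : ℤ) = 16 * N4 q S := by
  have h : ∀ y z : Fin (2 * q), (Ideg (2 * q) (lift4 q S) y z : ℤ) *
      (((2 * q : ℕ) : ℤ) - Odeg (2 * q) (lift4 q S) y z) =
      4 * ((Ideg q S (halfFin y) (halfFin z) : ℤ) *
        (q - Odeg q S (halfFin y) (halfFin z))) := by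
    intro y z
    rw [Ideg_lift4, Odeg_lift4]
    push_cast
    ring
  simp only [N4_eq_sum_s12, h, ← Finset.mul_sum]
  have h₂ : ∀ y : Fin (2 * q), ∑ z : Fin (2 * q),
      (Ideg q S (halfFin y) (halfFin z) : ℤ) * (q - Odeg q S (halfFin y) (halfFin z)) =
      2 * ∑ z, (Ideg q S (halfFin y) z : ℤ) * (q - Odeg q S (halfFin y) z) := fun y =>
    sum_comp_halfFin fun z =>
      (Ideg q S (halfFin y) z : ℤ) * (q - Odeg q S (halfFin y) z)
  simp only [h₂, ← Finset.mul_sum]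
  rw [sum_comp_halfFin fun y => ∑ z, (Ideg q S y z : ℤ) * (q - Odeg q S y z)]
  ring

end Lift

/-- The effect on `N4` of adding `P` to and removing `M` from a set `X`. -/
theorem N4_union_sdiff {n : ℕ} {X P M : Finset (Fin n × Fin n × Fin n)}
    (hP : Disjoint P X) (hM : M ⊆ X) :
    (N4 n ((X ∪ P) \ M) : ℤ) = N4 n X
      + ((∑ p ∈ P, ((n : ℤ) - Odeg n X p.2.1 p.2.2 - (Odeg n P p.2.1 p.2.2 - Odeg n M p.2.1 p.2.2)))
        - ∑ p ∈ M, ((n : ℤ) - Odeg n X p.2.1 p.2.2 -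
            (Odeg n P p.2.1 p.2.2 - Odeg n M p.2.1 p.2.2)))
      - ((∑ p ∈ P, (Ideg n X p.1 p.2.1 : ℤ)) - ∑ p ∈ M, (Ideg n X p.1 p.2.1 : ℤ)) := by
  rw [← sum_Ideg_mul P fun y z => (n : ℤ) - Odeg n X y z - (Odeg n P y z - Odeg n M y z),
    ← sum_Ideg_mul M fun y z => (n : ℤ) - Odeg n X y z - (Odeg n P y z - Odeg n M y z),
    ← sum_Odeg_mul P fun y z => (Ideg n X y z : ℤ),
    ← sum_Odeg_mul M fun y z => (Ideg n X y z : ℤ)]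
  simp only [N4_eq_sum_s12, Ideg_union_sdiff hP hM, Odeg_union_sdiff hP hM,
    ← Finset.sum_add_distrib, ← Finset.sum_sub_distrib]
  refine Finset.sum_congr rfl fun y _ => Finset.sum_congr rfl fun z _ => ?_
  ring

/-- under H_q(a,b;S) with a ≠ b, the gadget set T satisfies
N_{4,2q}(T) = 16·N_{4,q}(S) + 1. -/
theorem N4_gadget (q : ℕ) (hq : 1 ≤ q) (S : Finset (Fin q × Fin q × Fin q))
    (a b : Fin q) (hab : a ≠ b) (hH : Hq q a b S) :
    N4 (2 * q) (gadget q a b S) = 16 * N4 q S + 1 := by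
  obtain ⟨haaa, hbba, hbaa, hbbb, h₁, h₂, h₃, h₄⟩ := hH
  zify
  rw [gadget, N4_union_sdiff, N4_lift4]
  · simp only [Ideg_lift4, Odeg_lift4, Finset.sum_insert, Finset.sum_singleton,
      Finset.mem_insert, Finset.mem_singleton, Prod.mk.injEq,
      dbl0_ne_dbl1, dbl1_ne_dbl0, halfFin_dbl0, halfFin_dbl1, and_false, false_and,
      and_self, or_self, not_false_eq_true]
    generalize Odeg q S a a = oaa, Odeg q S b b = obb, Odeg q S b a = oba at *
    simp [Odeg, hab, hab.symm, Finset.filter_or, Finset.filter_eq']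
    omega
  · simp [lift4, hbaa, hbbb]
  · simp [Finset.insert_subset_iff, lift4, haaa, hbba]
end

section
/- For every integer m ≥ 4 there exists a set S ⊆ [2^m]^3 such that 240·N_{4,2^m}(S) = 91·2^{4m} − 16; equivalently, N_{4,2^m}(S) = (91/240)·(2^m)^4 − 1/15. -/
open Finset

/-- `edgeSum s` is the bilinear form of the de Bruijn graph whose value on the indicator function
of a set `S` of triples is the number of quadruples leaving `S`. -/
def edgeSum {α : Type*} [Fintype α] (s : α → α → α → ℤ) : ℤ :=
  ∑ b, ∑ c, (∑ a, s a b c) * ∑ d, (1 - s b c d)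

/-- `s` is the indicator function of a set of triples which leaves exactly `N` quadruples, and
which leaves one more after removing some triple `(a, b, c)` and adding `(b, c, d)`. -/
structure IsSwappable {α : Type*} [Fintype α] (s : α → α → α → ℤ) (N : ℤ) (a b c d : α) :
    Prop where
  zero_or_one : ∀ x y z, s x y z = 0 ∨ s x y z = 1
  edgeSum_eq : edgeSum s = N
  ne_ab : a ≠ b
  ne_ac : a ≠ c
  ne_bc : b ≠ c
  ne_bd : b ≠ d
  mem : s a b c = 1
  notMem : s b c d = 0
  balanced : ∑ x, s x a b + ∑ x, (1 - s c d x) = ∑ x, s x b c + ∑ x, (1 - s b c x)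

/-- Remove the triple `(a, b, c)` and add the triple `(b, c, d)`. -/
def swapTriple {α : Type*} [DecidableEq α] (s : α → α → α → ℤ) (a b c d : α) :
    α → α → α → ℤ := fun x y z =>
  s x y z - (if x = a then if y = b then if z = c then 1 else 0 else 0 else 0)
    + (if x = b then if y = c then if z = d then 1 else 0 else 0 else 0)

/-- Replace every letter by two copies of itself. -/
def blowUp {α : Type*} (s : α → α → α → ℤ) : α × Bool → α × Bool → α × Bool → ℤ :=
  fun x y z => s x.1 y.1 z.1

theorem edgeSum_blowUp {α : Type*} [Fintype α] (s : α → α → α → ℤ) :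
    edgeSum (blowUp s) = 16 * edgeSum s := by
  simp only [edgeSum, blowUp, Fintype.sum_prod_type, Fintype.sum_bool, ← two_mul, ← mul_sum]
  simp only [mul_sum]
  refine sum_congr rfl fun b _ => sum_congr rfl fun c _ => ?_
  simp only [← mul_sum]
  ring

theorem edgeSum_swapTriple {α : Type*} [Fintype α] [DecidableEq α] (s : α → α → α → ℤ)
    {a b c d : α} (hab : a ≠ b) (hac : a ≠ c) (hbc : b ≠ c) (hbd : b ≠ d) :
    edgeSum (swapTriple s a b c d) = edgeSum s + 1
      + (∑ x, s x a b + ∑ x, (1 - s c d x)) - (∑ x, s x b c + ∑ x, (1 - s b c x)) := by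
  have hin : ∀ y z, ∑ x, swapTriple s a b c d x y z = ∑ x, s x y z
      - (if y = b then if z = c then 1 else 0 else 0)
      + (if y = c then if z = d then 1 else 0 else 0) := by
    intro y z
    simp [swapTriple, sum_add_distrib, sum_sub_distrib]
  have hout : ∀ y z, ∑ x, (1 - swapTriple s a b c d y z x) = ∑ x, (1 - s y z x)
      + (if y = a then if z = b then 1 else 0 else 0)
      - (if y = b then if z = c then 1 else 0 else 0) := by
    intro y z
    simp only [swapTriple, sum_add_distrib, sum_sub_distrib]
    split_ifs <;> simp <;> ring
  simp only [edgeSum, hin, hout]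
  generalize hP : (fun y z => ∑ x, s x y z) = P
  generalize hR : (fun y z => ∑ x, (1 - s y z x)) = R
  have hP' : ∀ y z, ∑ x, s x y z = P y z := fun y z => by rw [← hP]
  have hR' : ∀ y z, ∑ x, (1 - s y z x) = R y z := fun y z => by rw [← hR]
  simp only [hP', hR']
  have key : ∀ y z, (P y z - (if y = b then if z = c then 1 else 0 else 0)
      + (if y = c then if z = d then 1 else 0 else 0)) *
      (R y z + (if y = a then if z = b then 1 else 0 else 0)
      - (if y = b then if z = c then 1 else 0 else 0)) = P y z * R y z
      + (if y = a then if z = b then P a b else 0 else 0)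
      + (if y = c then if z = d then R c d else 0 else 0)
      - (if y = b then if z = c then P b c + R b c - 1 else 0 else 0) := by
    intro y z
    split_ifs <;> subst_vars <;> first | contradiction | ring
  simp only [key, sum_add_distrib, sum_sub_distrib]
  simp
  ring

theorem IsSwappable.exists_prod_bool {α : Type*} [Fintype α] {s : α → α → α → ℤ} {N : ℤ}
    {a b c d : α} (h : IsSwappable s N a b c d) :
    ∃ (t : α × Bool → α × Bool → α × Bool → ℤ) (a' b' c' d' : α × Bool),
      IsSwappable t (16 * N + 1) a' b' c' d' := by
  classical
  have hbal := h.balanced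
  refine ⟨swapTriple (blowUp s) (a, false) (b, false) (c, false) (d, false),
    (a, true), (b, true), (c, true), (d, true), ?_, ?_, ?_, ?_, ?_, ?_, ?_, ?_, ?_⟩
  · intro x y z
    by_cases h1 : x = (a, false) ∧ y = (b, false) ∧ z = (c, false)
    · obtain ⟨rfl, rfl, rfl⟩ := h1
      simp [swapTriple, blowUp, h.mem, h.ne_ab]
    · by_cases h2 : x = (b, false) ∧ y = (c, false) ∧ z = (d, false)
      · obtain ⟨rfl, rfl, rfl⟩ := h2
        simp [swapTriple, blowUp, h.notMem, h.ne_ab.symm]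
      · have := h.zero_or_one x.1 y.1 z.1
        simp only [← ite_and, swapTriple, blowUp, if_neg h1, if_neg h2]
        simpa using this
  · rw [edgeSum_swapTriple, edgeSum_blowUp, h.edgeSum_eq]
    · simp only [blowUp, Fintype.sum_prod_type, Fintype.sum_bool, ← two_mul, ← mul_sum]
      linarith
    all_goals simp [h.ne_ab, h.ne_ac, h.ne_bc, h.ne_bd]
  · simp [h.ne_ab]
  · simp [h.ne_ac]
  · simp [h.ne_bc]
  · simp [h.ne_bd]
  · simp [swapTriple, blowUp, h.mem]
  · simp [swapTriple, blowUp, h.notMem]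
  · simp [swapTriple, blowUp, Fintype.sum_prod_type, ← mul_sum, ← two_mul] at hbal ⊢
    linarith

theorem edgeSum_comp_equiv {α β : Type*} [Fintype α] [Fintype β] (e : β ≃ α)
    (s : α → α → α → ℤ) : edgeSum (fun x y z => s (e x) (e y) (e z)) = edgeSum s := by
  unfold edgeSum
  rw [← e.sum_comp]
  refine sum_congr rfl fun b _ => ?_
  rw [← e.sum_comp]
  refine sum_congr rfl fun c _ => ?_
  rw [← e.sum_comp, ← e.sum_comp]

theorem IsSwappable.comp_equiv {α β : Type*} [Fintype α] [Fintype β] (e : β ≃ α)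
    {s : α → α → α → ℤ} {N : ℤ} {a b c d : α} (h : IsSwappable s N a b c d) :
    IsSwappable (fun x y z => s (e x) (e y) (e z)) N
      (e.symm a) (e.symm b) (e.symm c) (e.symm d) where
  zero_or_one _ _ _ := h.zero_or_one _ _ _
  edgeSum_eq := (edgeSum_comp_equiv e s).trans h.edgeSum_eq
  ne_ab := by simpa using h.ne_ab
  ne_ac := by simpa using h.ne_ac
  ne_bc := by simpa using h.ne_bc
  ne_bd := by simpa using h.ne_bd
  mem := by simpa using h.mem
  notMem := by simpa using h.notMem
  balanced := by
    simp only [Equiv.apply_symm_apply]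
    rw [e.sum_comp fun x => s x a b, e.sum_comp fun x => 1 - s c d x,
      e.sum_comp fun x => s x b c, e.sum_comp fun x => 1 - s b c x]
    exact h.balanced

/-- The indicator function of a set of triples over sixteen letters, stored as a bit mask. -/
def sixteenLetters (x y z : Fin 16) : ℤ :=
  if Nat.testBit
    787319574292483297775199675921302058993037066751382388675497516167750024505994697087205554756199410683840093186266578998060734819153338703455444178109824310424491454901018063494214955808670160578708867012100996941586021236378492965842879468073266740464317899258165043633858563141354975351144758063077639644003120910714573613985162541623613046039310195664531161344327049198348354557726454932450334321336242321194982447019342339461134060929383442118603429570313372331116135900206949814482193480339004942637214480647077489748257495297626966802759045377779511341443180374105213288688957345760184313782875660855871464650302955485683149615990952579313558697315261247414067521156902203614079716572387480280634593195652812775797721629749135204124886432326211507211943552925947582933682988514805121791713118552288540749671392377746280520738025426502406431784459233161068443940958879916542272448111164009517231262237855860890831737496614068833565888425550397959822400566427040689381617344039060072007985417764078275577955257159995881367097260731659898874910766668134632211380806928384688655914844603077882552315838101478020750922513153705547040979156868467955661298870379375653845771456490257809115452738168043709995958651033196991525383164156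
    (256 * x + 16 * y + z) then 1 else 0

theorem isSwappable_sixteenLetters : IsSwappable sixteenLetters 24849 1 0 5 14 where
  zero_or_one x y z := by unfold sixteenLetters; split_ifs <;> simp
  edgeSum_eq := by decide +kernel
  ne_ab := by decide
  ne_ac := by decide
  ne_bc := by decide
  ne_bd := by decide
  mem := by decide +kernel
  notMem := by decide +kernel
  balanced := by decide +kernel

theorem exists_isSwappable_two_pow (k : ℕ) :
    ∃ (N : ℤ) (s : Fin (2 ^ (k + 4)) → Fin (2 ^ (k + 4)) → Fin (2 ^ (k + 4)) → ℤ)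
      (a b c d : Fin (2 ^ (k + 4))),
      240 * N = 91 * 2 ^ (4 * (k + 4)) - 16 ∧ IsSwappable s N a b c d := by
  induction k with
  | zero => exact ⟨24849, sixteenLetters, 1, 0, 5, 14, by norm_num, isSwappable_sixteenLetters⟩
  | succ k ih =>
    obtain ⟨N, s, a, b, c, d, hN, h⟩ := ih
    obtain ⟨t, a', b', c', d', ht⟩ := h.exists_prod_bool
    have e : Fin (2 ^ (k + 1 + 4)) ≃ Fin (2 ^ (k + 4)) × Bool :=
      Fintype.equivOfCardEq (by simp; ring)
    refine ⟨16 * N + 1, _, _, _, _, _, ?_, ht.comp_equiv e⟩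
    have : (2 : ℤ) ^ (4 * (k + 1 + 4)) = 16 * 2 ^ (4 * (k + 4)) := by
      rw [show 4 * (k + 1 + 4) = 4 * (k + 4) + 4 by ring, pow_add]; ring
    rw [this]; linarith

theorem N4_eq_edgeSum (q : ℕ) (S : Finset (Fin q × Fin q × Fin q)) :
    (N4 q S : ℤ) = edgeSum fun x y z => if (x, y, z) ∈ S then 1 else 0 := by
  simp only [N4, card_filter, edgeSum, Fintype.sum_prod_type, sum_mul_sum]
  push_cast
  rw [sum_comm]
  refine sum_congr rfl fun b _ => ?_
  rw [sum_comm]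
  refine sum_congr rfl fun c _ => sum_congr rfl fun a _ => sum_congr rfl fun d _ => ?_
  by_cases h1 : (a, b, c) ∈ S <;> by_cases h2 : (b, c, d) ∈ S <;> simp [h1, h2]

/-- for every m ≥ 4 there is S ⊆ [2^m]³ with
240·N_{4,2^m}(S) = 91·2^{4m} − 16, i.e. N_{4,2^m}(S) = (91/240)·(2^m)⁴ − 1/15. -/
theorem exists_dyadic_lower_bound_set (m : ℕ) (hm : 4 ≤ m) :
    ∃ S : Finset (Fin (2 ^ m) × Fin (2 ^ m) × Fin (2 ^ m)),
      240 * N4 (2 ^ m) S = 91 * 2 ^ (4 * m) - 16 := by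
  obtain ⟨k, rfl⟩ := Nat.exists_eq_add_of_le' hm
  obtain ⟨N, s, a, b, c, d, hN, h⟩ := exists_isSwappable_two_pow k
  refine ⟨univ.filter fun x => s x.1 x.2.1 x.2.2 = 1, ?_⟩
  have hs : (fun x y z => if (x, y, z) ∈ univ.filter
      (fun x : Fin (2 ^ (k + 4)) × Fin (2 ^ (k + 4)) × Fin (2 ^ (k + 4)) =>
        s x.1 x.2.1 x.2.2 = 1) then (1 : ℤ) else 0) = s := by
    funext x y z
    rcases h.zero_or_one x y z with h0 | h0 <;> simp [h0]
  have key := N4_eq_edgeSum (2 ^ (k + 4)) (univ.filter fun x => s x.1 x.2.1 x.2.2 = 1)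
  rw [hs, h.edgeSum_eq] at key
  rw [← key] at hN
  zify at hN ⊢
  have : 16 ≤ 91 * 2 ^ (4 * (k + 4)) := by
    have := Nat.one_le_two_pow (n := 4 * k)
    rw [show 4 * (k + 4) = 4 * k + 16 by ring, pow_add]
    omega
  rw [Nat.cast_sub this]
  push_cast
  exact hN
end

section
/- One has 91/240 ≤ λ_3 ≤ 11/28 (and in particular 3/8 < λ_3 < 2/5). -/
open MeasureTheory

/-- The uniform distribution on `[0,1]`. -/
noncomputable def unif : Measure ℝ := volume.restrict (Set.Icc 0 1)

instance isProbabilityMeasure_unif : IsProbabilityMeasure unif :=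
  ⟨by simp [unif]⟩

/-- The distribution of four independent uniform points of `[0,1]`. -/
noncomputable def unif4 : Measure (Fin 4 → ℝ) := Measure.pi fun _ => unif

instance isProbabilityMeasure_unif4 : IsProbabilityMeasure unif4 := by
  unfold unif4; infer_instance

theorem restrict_unitCube_four :
    (volume : Measure (Fin 4 → ℝ)).restrict (unitCube 4) = unif4 := by
  simp only [unitCube, unif4, unif, volume_pi, Measure.restrict_pi_pi]

theorem ae_mem_unitCube_four : ∀ᵐ x ∂unif4, x ∈ unitCube 4 := by
  rw [← restrict_unitCube_four]
  exact ae_restrict_mem (MeasurableSet.univ_pi fun _ => measurableSet_Icc)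

theorem integral_unif4_perm (σ : Equiv.Perm (Fin 4)) (F : (Fin 4 → ℝ) → ℝ) :
    ∫ x, F (x ∘ σ) ∂unif4 = ∫ x, F x ∂unif4 := by
  have h := measurePreserving_piCongrLeft (fun _ : Fin 4 => unif) σ.symm
  rw [unif4, ← h.integral_comp' F]
  refine integral_congr_ae (Filter.Eventually.of_forall fun x => ?_)
  refine congrArg F (funext fun i => ?_)
  have := Equiv.piCongrLeft_apply (P := fun _ : Fin 4 => ℝ) σ.symm x i
  simp [MeasurableEquiv.coe_piCongrLeft, this]

theorem integral_pi_succ (n : ℕ) (F : (Fin (n + 1) → ℝ) → ℝ)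
    (hF : Integrable F (Measure.pi fun _ => unif)) :
    ∫ x, F x ∂(Measure.pi fun _ => unif) =
      ∫ a, ∫ y, F (Fin.cons a y) ∂(Measure.pi fun _ : Fin n => unif) ∂unif := by
  have h := (measurePreserving_piFinSuccAbove (fun _ : Fin (n + 1) => unif) 0).symm
  rw [← h.integral_comp' F, integral_prod]
  · simp [MeasurableEquiv.piFinSuccAbove_symm_apply, Fin.insertNthEquiv]
  · exact (h.integrable_comp_emb (MeasurableEquiv.measurableEmbedding _)).2 hF

theorem integrable_of_measurable_of_bound {α : Type*} [MeasurableSpace α] {μ : Measure α}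
    [IsFiniteMeasure μ] {F : α → ℝ} (hF : Measurable F) {C : ℝ} (hC : ∀ x, |F x| ≤ C) :
    Integrable F μ :=
  Integrable.of_bound hF.aestronglyMeasurable C (Filter.Eventually.of_forall hC)

theorem integral_unif4_eq_iterated {F : (Fin 4 → ℝ) → ℝ} (hF : Measurable F) {C : ℝ}
    (hC : ∀ x, |F x| ≤ C) :
    ∫ x, F x ∂unif4 = ∫ a, ∫ b, ∫ c, ∫ d, F ![a, b, c, d] ∂unif ∂unif ∂unif ∂unif := by
  have aux : ∀ (n : ℕ) (G : (Fin n → ℝ) → ℝ), Measurable G → (∀ x, |G x| ≤ C) →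
      Integrable G (Measure.pi fun _ => unif) := fun n G hG hb =>
    integrable_of_measurable_of_bound hG hb
  have hcons : ∀ (n : ℕ) (a : ℝ), Measurable fun y : Fin n → ℝ =>
      (Fin.cons a y : Fin (n + 1) → ℝ) := fun n a => by
    refine measurable_pi_lambda _ fun i => ?_
    refine Fin.cases ?_ (fun j => ?_) i
    · simp
    · simpa using measurable_pi_apply j
  rw [unif4, integral_pi_succ 3 F (aux _ _ hF hC)]
  refine integral_congr_ae (Filter.Eventually.of_forall fun a => ?_)
  have h3 := hF.comp (hcons 3 a)
  refine (integral_pi_succ 2 _ (aux _ _ h3 fun _ => hC _)).trans ?_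
  refine integral_congr_ae (Filter.Eventually.of_forall fun b => ?_)
  have h2 := h3.comp (hcons 2 b)
  refine (integral_pi_succ 1 _ (aux _ _ h2 fun _ => hC _)).trans ?_
  refine integral_congr_ae (Filter.Eventually.of_forall fun c => ?_)
  have h1 := h2.comp (hcons 1 c)
  refine (integral_pi_succ 0 _ (aux _ _ h1 fun _ => hC _)).trans ?_
  refine integral_congr_ae (Filter.Eventually.of_forall fun d => ?_)
  have hd : ∀ y : Fin 0 → ℝ, (Fin.cons a (Fin.cons b (Fin.cons c (Fin.cons d y)) : Fin 3 → ℝ) :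
      Fin 4 → ℝ) = ![a, b, c, d] := fun y => by
    ext i
    fin_cases i <;> rfl
  simp [hd]

theorem Phi_three_eq_s15 {A : Set (Fin 3 → ℝ)} :
    Phi 3 A = ∫ x, A.indicator (fun _ => (1 : ℝ)) ![x 0, x 1, x 2] *
      (1 - A.indicator (fun _ => (1 : ℝ)) ![x 1, x 2, x 3]) ∂unif4 := by
  have h1 : ∀ x : Fin 4 → ℝ, (fun i : Fin 3 => x i.castSucc) = ![x 0, x 1, x 2] := fun x => by
    ext i; fin_cases i <;> rfl
  have h2 : ∀ x : Fin 4 → ℝ, (fun i : Fin 3 => x i.succ) = ![x 1, x 2, x 3] := fun x => by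
    ext i; fin_cases i <;> rfl
  simp only [Phi, h1, h2]
  rw [← restrict_unitCube_four]

section UpperBound

variable {s : (Fin 3 → ℝ) → ℝ}

theorem measurable_comp_triple {α : Type*} [MeasurableSpace α] (hs : Measurable s)
    {p q r : α → ℝ} (hp : Measurable p) (hq : Measurable q) (hr : Measurable r) :
    Measurable fun x => s ![p x, q x, r x] := by
  refine hs.comp (measurable_pi_lambda _ fun i => ?_)
  fin_cases i <;> assumption

/-- For `k` depending on `x 0, x 1` and one further coordinate, two conditionally independent
copies of `k` are nonnegatively correlated. -/
theorem integral_mul_copy_nonneg {k : ℝ → ℝ → ℝ → ℝ}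
    (hk : Measurable fun x : Fin 3 → ℝ => k (x 0) (x 1) (x 2)) {C : ℝ}
    (hC : ∀ a b c, |k a b c| ≤ C) :
    0 ≤ ∫ x, k (x 0) (x 1) (x 2) * k (x 0) (x 1) (x 3) ∂unif4 := by
  have hm : Measurable fun x : Fin 4 → ℝ => k (x 0) (x 1) (x 2) * k (x 0) (x 1) (x 3) := by
    have h1 : Measurable fun x : Fin 4 → ℝ => k (x 0) (x 1) (x 2) :=
      measurable_comp_triple (s := fun x => k (x 0) (x 1) (x 2)) hk
        (measurable_pi_apply 0) (measurable_pi_apply 1) (measurable_pi_apply 2)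
    have h2 : Measurable fun x : Fin 4 → ℝ => k (x 0) (x 1) (x 3) :=
      measurable_comp_triple (s := fun x => k (x 0) (x 1) (x 2)) hk
        (measurable_pi_apply 0) (measurable_pi_apply 1) (measurable_pi_apply 3)
    exact h1.mul h2
  rw [integral_unif4_eq_iterated hm (C := C * C)]
  · refine integral_nonneg fun a => integral_nonneg fun b => ?_
    have : ∫ c, ∫ d, k a b c * k a b d ∂unif ∂unif = (∫ c, k a b c ∂unif) ^ 2 := by
      simp only [integral_const_mul, integral_mul_const, sq]
    simpa [this] using sq_nonneg (∫ c, k a b c ∂unif)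
  · intro x
    rw [abs_mul]
    exact mul_le_mul (hC _ _ _) (hC _ _ _) (abs_nonneg _) ((abs_nonneg _).trans (hC 0 0 0))

/-- The correlation of `s` at two triples of coordinates of a random point. -/
noncomputable def corr (s : (Fin 3 → ℝ) → ℝ) (i j k l m n : Fin 4) : ℝ :=
  ∫ x, s ![x i, x j, x k] * s ![x l, x m, x n] ∂unif4

theorem corr_perm (σ : Equiv.Perm (Fin 4)) (i j k l m n : Fin 4) :
    corr s (σ i) (σ j) (σ k) (σ l) (σ m) (σ n) = corr s i j k l m n :=
  integral_unif4_perm σ fun x => s ![x i, x j, x k] * s ![x l, x m, x n]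

theorem corr_comm (i j k l m n : Fin 4) : corr s i j k l m n = corr s l m n i j k := by
  simp only [corr, mul_comm]

theorem integrable_sign_mul (hs : Measurable s) (h1 : ∀ x, s x = 1 ∨ s x = -1)
    (i j k l m n : Fin 4) :
    Integrable (fun x : Fin 4 → ℝ => s ![x i, x j, x k] * s ![x l, x m, x n]) unif4 := by
  refine integrable_of_measurable_of_bound (C := 1) ?_ fun x => ?_
  · exact (measurable_comp_triple hs (measurable_pi_apply i) (measurable_pi_apply j)
      (measurable_pi_apply k)).mul (measurable_comp_triple hs (measurable_pi_apply l)
      (measurable_pi_apply m) (measurable_pi_apply n))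
  · rcases h1 ![x i, x j, x k] with h | h <;> rcases h1 ![x l, x m, x n] with h' | h' <;>
      simp [h, h']

theorem corr_le_one (hs : Measurable s) (h1 : ∀ x, s x = 1 ∨ s x = -1) (i j k l m n : Fin 4) :
    corr s i j k l m n ≤ 1 := by
  have := integral_mono (integrable_sign_mul hs h1 i j k l m n)
    (integrable_const (μ := unif4) (1 : ℝ)) fun x => by
      rcases h1 ![x i, x j, x k] with h | h <;> rcases h1 ![x l, x m, x n] with h' | h' <;>
        simp [h, h']
  simpa [corr] using this

theorem corr_triangle (hs : Measurable s) (h1 : ∀ x, s x = 1 ∨ s x = -1)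
    (i j k l m n p q r : Fin 4) :
    corr s i j k l m n + corr s i j k p q r ≤ 1 + corr s l m n p q r := by
  have I := integrable_sign_mul hs h1
  have := integral_mono ((I i j k l m n).add (I i j k p q r))
    ((integrable_const (μ := unif4) (1 : ℝ)).add (I l m n p q r)) fun x => by
      rcases h1 ![x i, x j, x k] with h | h <;> rcases h1 ![x l, x m, x n] with h' | h' <;>
        rcases h1 ![x p, x q, x r] with h'' | h'' <;> simp [h, h', h''] <;> norm_num
  rw [integral_add' (I i j k l m n) (I i j k p q r),
    integral_add' (integrable_const _) (I l m n p q r)] at this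
  simpa [corr] using this

theorem corr_quadratic_nonneg (hs : Measurable s) (h1 : ∀ x, s x = 1 ∨ s x = -1) :
    0 ≤ corr s 2 0 1 3 0 1 + corr s 0 1 2 0 1 3 + corr s 0 2 1 0 3 1 / 4 +
      (corr s 2 0 1 0 1 3 + corr s 0 1 2 3 0 1) +
      (corr s 2 0 1 0 3 1 + corr s 0 2 1 3 0 1) / 2 +
      (corr s 0 1 2 0 3 1 + corr s 0 2 1 0 1 3) / 2 := by
  have hm : Measurable fun x : Fin 3 → ℝ =>
      s ![x 2, x 0, x 1] + s ![x 0, x 1, x 2] + s ![x 0, x 2, x 1] / 2 :=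
    ((measurable_comp_triple hs (measurable_pi_apply 2) (measurable_pi_apply 0)
      (measurable_pi_apply 1)).add (measurable_comp_triple hs (measurable_pi_apply 0)
      (measurable_pi_apply 1) (measurable_pi_apply 2))).add
      ((measurable_comp_triple hs (measurable_pi_apply 0) (measurable_pi_apply 2)
      (measurable_pi_apply 1)).div_const 2)
  have h := integral_mul_copy_nonneg (C := 3)
    (k := fun a b c => s ![c, a, b] + s ![a, b, c] + s ![a, c, b] / 2) hm fun a b c => by
      rcases h1 ![c, a, b] with h | h <;> rcases h1 ![a, b, c] with h' | h' <;>
        rcases h1 ![a, c, b] with h'' | h'' <;> rw [h, h', h''] <;> norm_num [abs_le]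
  have I := integrable_sign_mul hs h1
  refine h.trans_eq ?_
  simp only [corr]
  rw [← integral_div, ← integral_add (I _ _ _ _ _ _) (I _ _ _ _ _ _),
    ← integral_add (I _ _ _ _ _ _) (I _ _ _ _ _ _),
    ← integral_add (I _ _ _ _ _ _) (I _ _ _ _ _ _),
    ← integral_add (I _ _ _ _ _ _) (I _ _ _ _ _ _),
    ← integral_div, ← integral_div,
    ← integral_add, ← integral_add, ← integral_add, ← integral_add]
  · refine integral_congr_ae (Filter.Eventually.of_forall fun x => ?_)
    simp only
    ring
  all_goals
    repeat' first
      | exact I _ _ _ _ _ _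
      | refine Integrable.div_const ?_ _
      | refine Integrable.add ?_ ?_

/-- A `±1`-valued `s` has `E s(x₀,x₁,x₂) s(x₁,x₂,x₃) ≥ -9/16`. -/
theorem corr_shift_ge (hs : Measurable s) (h1 : ∀ x, s x = 1 ∨ s x = -1) :
    -9 / 16 ≤ corr s 0 1 2 1 2 3 := by
  have hq := corr_quadratic_nonneg hs h1
  have hη := corr_le_one hs h1 0 2 1 0 3 1
  have t1 := corr_triangle hs h1 0 1 2 0 1 3 1 3 2
  have t2 := corr_triangle hs h1 2 1 0 3 1 0 2 3 1
  have e1 : corr s 0 1 2 1 2 3 = corr s 2 0 1 0 1 3 :=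
    corr_perm ⟨![1, 2, 0, 3], ![2, 0, 1, 3], by decide, by decide⟩ 2 0 1 0 1 3
  have e2 : corr s 0 1 2 1 2 3 = corr s 3 0 1 0 1 2 :=
    corr_perm ⟨![1, 2, 3, 0], ![3, 0, 1, 2], by decide, by decide⟩ 3 0 1 0 1 2
  have e3 : corr s 2 0 1 0 3 1 = corr s 3 0 1 0 2 1 :=
    corr_perm ⟨![0, 1, 3, 2], ![0, 1, 3, 2], by decide, by decide⟩ 3 0 1 0 2 1
  have e4 : corr s 0 1 2 0 3 1 = corr s 0 1 3 0 2 1 :=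
    corr_perm ⟨![0, 1, 3, 2], ![0, 1, 3, 2], by decide, by decide⟩ 0 1 3 0 2 1
  have e5 : corr s 2 0 1 0 3 1 = corr s 0 1 2 1 3 2 :=
    corr_perm ⟨![2, 0, 1, 3], ![1, 2, 0, 3], by decide, by decide⟩ 0 1 2 1 3 2
  have e6 : corr s 0 1 2 1 2 3 = corr s 0 1 3 1 3 2 :=
    corr_perm ⟨![0, 1, 3, 2], ![0, 1, 3, 2], by decide, by decide⟩ 0 1 3 1 3 2
  have e7 : corr s 2 0 1 3 0 1 = corr s 2 1 0 3 1 0 :=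
    corr_perm ⟨![1, 0, 2, 3], ![1, 0, 2, 3], by decide, by decide⟩ 2 1 0 3 1 0
  have e8 : corr s 0 1 2 0 3 1 = corr s 2 1 0 2 3 1 :=
    corr_perm ⟨![2, 1, 0, 3], ![2, 1, 0, 3], by decide, by decide⟩ 2 1 0 2 3 1
  have e9 : corr s 0 1 2 1 2 3 = corr s 2 3 1 3 1 0 :=
    corr_perm ⟨![3, 2, 0, 1], ![2, 3, 1, 0], by decide, by decide⟩ 2 3 1 3 1 0
  rw [corr_comm 0 1 2 3 0 1, corr_comm 0 2 1 3 0 1, corr_comm 0 2 1 0 1 3] at hq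
  rw [corr_comm 3 1 0 2 3 1] at t2
  linarith

theorem Phi_three_le_s15 {A : Set (Fin 3 → ℝ)} (hA : MeasurableSet A) : Phi 3 A ≤ 25 / 64 := by
  classical
  set s : (Fin 3 → ℝ) → ℝ := fun y => 2 * A.indicator (fun _ => (1 : ℝ)) y - 1 with hs_def
  have hs : Measurable s := ((measurable_const.indicator hA).const_mul 2).sub_const 1
  have h1 : ∀ y, s y = 1 ∨ s y = -1 := fun y => by
    by_cases h : y ∈ A
    · left; simp [hs_def, h]; norm_num
    · right; simp [hs_def, h]
  have hI : ∀ i j k : Fin 4, Integrable (fun x : Fin 4 → ℝ => s ![x i, x j, x k]) unif4 :=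
    fun i j k => integrable_of_measurable_of_bound (C := 1)
      (measurable_comp_triple hs (measurable_pi_apply i) (measurable_pi_apply j)
        (measurable_pi_apply k)) fun x => by rcases h1 ![x i, x j, x k] with h | h <;> simp [h]
  have hshift : ∫ x, s ![x 1, x 2, x 3] ∂unif4 = ∫ x, s ![x 0, x 1, x 2] ∂unif4 :=
    integral_unif4_perm (finRotate 4) fun x => s ![x 0, x 1, x 2]
  have hcorr := corr_shift_ge hs h1
  have key : Phi 3 A = (1 - corr s 0 1 2 1 2 3) / 4 := by
    have h4 : Phi 3 A = ∫ x, (1 + s ![x 0, x 1, x 2] - s ![x 1, x 2, x 3] -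
        s ![x 0, x 1, x 2] * s ![x 1, x 2, x 3]) / 4 ∂unif4 := by
      rw [Phi_three_eq_s15]
      refine integral_congr_ae (Filter.Eventually.of_forall fun x => ?_)
      simp only [hs_def]
      ring
    have I0 : Integrable (fun _ : Fin 4 → ℝ => (1 : ℝ)) unif4 := integrable_const _
    have I1 := I0.add (hI 0 1 2)
    have I2 := I1.sub (hI 1 2 3)
    rw [h4, integral_div]
    erw [integral_sub I2 (integrable_sign_mul hs h1 0 1 2 1 2 3), integral_sub I1 (hI 1 2 3),
      integral_add I0 (hI 0 1 2)]
    rw [hshift]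
    simp [corr]
  rw [key]
  linarith

end UpperBound

section LowerBound

theorem integral_unif_floor (φ : ℕ → ℝ) :
    ∫ x, φ ⌊10 * x⌋₊ ∂unif = (∑ i ∈ Finset.range 10, φ i) / 10 := by
  have hpiece : ∀ i : ℕ, Set.EqOn (fun x : ℝ => φ ⌊10 * x⌋₊) (fun _ => φ i)
      (Set.Ico ((i : ℝ) / 10) (((i + 1 : ℕ) : ℝ) / 10)) := by
    intro i x hx
    have : ⌊10 * x⌋₊ = i := by
      rw [Nat.floor_eq_iff (by have := hx.1; have : (0 : ℝ) ≤ i / 10 := by positivity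
                               linarith)]
      have h1 := hx.1
      have h2 := hx.2
      push_cast at h2
      constructor <;> linarith
    simp [this]
  have hle : ∀ i : ℕ, (i : ℝ) / 10 ≤ ((i + 1 : ℕ) : ℝ) / 10 := fun i => by
    push_cast; linarith
  have hae : ∀ i : ℕ, (fun x : ℝ => φ ⌊10 * x⌋₊) =ᵐ[volume.restrict
      (Set.Ioc ((i : ℝ) / 10) (((i + 1 : ℕ) : ℝ) / 10))] fun _ => φ i := fun i => by
    rw [← restrict_Ico_eq_restrict_Ioc]
    exact (ae_restrict_mem measurableSet_Ico).mono fun x hx => hpiece i hx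
  have hint : ∀ i < (10 : ℕ), IntervalIntegrable (fun x : ℝ => φ ⌊10 * x⌋₊) volume
      ((i : ℝ) / 10) (((i + 1 : ℕ) : ℝ) / 10) := fun i _ => by
    rw [intervalIntegrable_iff_integrableOn_Ioc_of_le (hle i)]
    exact (integrable_congr (hae i)).2 (integrable_const _)
  have hsum := intervalIntegral.sum_integral_adjacent_intervals
    (a := fun i : ℕ => (i : ℝ) / 10) hint
  rw [unif, integral_Icc_eq_integral_Ioc, ← intervalIntegral.integral_of_le zero_le_one]
  norm_num at hsum
  rw [← hsum, Finset.sum_div]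
  refine Finset.sum_congr rfl fun i _ => ?_
  have h := hle i
  push_cast at h
  have h' := hae i
  push_cast at h'
  rw [intervalIntegral.integral_of_le h, integral_congr_ae h', integral_const,
    measureReal_restrict_apply_univ, Real.volume_real_Ioc_of_le h, smul_eq_mul]
  ring

/-- A set of triples in `{0,…,9}³`, encoded by the binary digits of a number. -/
def code (i j k : ℕ) : Bool :=
  Nat.testBit
    2270340202356622832777445678473620564832887430699015201706309861198886958753164240898324970755425359422087022332580307065415679488003894209656121736034360736379917319167547253925896253640779203906239067984559402304475148562271745257685147908038422953236383516248290484308235884186766606415123456418014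
    (100 * i + 10 * j + k)

theorem code_count :
    ∑ i ∈ Finset.range 10, ∑ j ∈ Finset.range 10, ∑ k ∈ Finset.range 10, ∑ l ∈ Finset.range 10,
      (if code i j k && !code j k l then 1 else 0) = 3792 := by
  decide +kernel

/-- The union of the cubes of side `1/10` selected by `code`. -/
def codeSet : Set (Fin 3 → ℝ) :=
  unitCube 3 ∩ {x | code ⌊10 * x 0⌋₊ ⌊10 * x 1⌋₊ ⌊10 * x 2⌋₊ = true}

theorem measurable_floor_ten {n : ℕ} (i : Fin n) :
    Measurable fun x : Fin n → ℝ => ⌊10 * x i⌋₊ :=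
  Nat.measurable_floor.comp ((measurable_pi_apply i).const_mul 10)

theorem measurableSet_codeSet : MeasurableSet codeSet := by
  refine (MeasurableSet.univ_pi fun _ => measurableSet_Icc).inter ?_
  have h : Measurable fun x : Fin 3 → ℝ => (⌊10 * x 0⌋₊, ⌊10 * x 1⌋₊, ⌊10 * x 2⌋₊) :=
    (measurable_floor_ten 0).prodMk ((measurable_floor_ten 1).prodMk (measurable_floor_ten 2))
  exact h (MeasurableSet.of_discrete (s := {p : ℕ × ℕ × ℕ | code p.1 p.2.1 p.2.2 = true}))

theorem Phi_codeSet : Phi 3 codeSet = 3792 / 10000 := by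
  set ψ : ℕ × ℕ × ℕ × ℕ → ℝ := fun p =>
    ((if code p.1 p.2.1 p.2.2.1 && !code p.2.1 p.2.2.1 p.2.2.2 then 1 else 0 : ℕ) : ℝ) with hψ
  have h1 : Phi 3 codeSet =
      ∫ x, ψ (⌊10 * x 0⌋₊, ⌊10 * x 1⌋₊, ⌊10 * x 2⌋₊, ⌊10 * x 3⌋₊) ∂unif4 := by
    rw [Phi_three_eq_s15]
    refine integral_congr_ae (ae_mem_unitCube_four.mono fun x hx => ?_)
    have hx' : ∀ i j k : Fin 4, ![x i, x j, x k] ∈ unitCube 3 := fun i j k l _ => by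
      fin_cases l
      · exact hx i trivial
      · exact hx j trivial
      · exact hx k trivial
    have hmem : ∀ i j k : Fin 4, ![x i, x j, x k] ∈ codeSet ↔
        code ⌊10 * x i⌋₊ ⌊10 * x j⌋₊ ⌊10 * x k⌋₊ = true := fun i j k =>
      ⟨fun h => h.2, fun h => ⟨hx' i j k, h⟩⟩
    classical
    beta_reduce
    rw [Set.indicator_apply, Set.indicator_apply, if_congr (hmem 0 1 2) rfl rfl,
      if_congr (hmem 1 2 3) rfl rfl]
    simp only [hψ]
    cases code ⌊10 * x 0⌋₊ ⌊10 * x 1⌋₊ ⌊10 * x 2⌋₊ <;>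
      cases code ⌊10 * x 1⌋₊ ⌊10 * x 2⌋₊ ⌊10 * x 3⌋₊ <;> simp
  have hm : Measurable fun x : Fin 4 → ℝ =>
      ψ (⌊10 * x 0⌋₊, ⌊10 * x 1⌋₊, ⌊10 * x 2⌋₊, ⌊10 * x 3⌋₊) :=
    (measurable_of_countable ψ).comp ((measurable_floor_ten 0).prodMk
      ((measurable_floor_ten 1).prodMk ((measurable_floor_ten 2).prodMk (measurable_floor_ten 3))))
  have hb : ∀ p, |ψ p| ≤ 1 := fun p => by
    simp only [hψ]
    split_ifs <;> simp
  rw [h1, integral_unif4_eq_iterated hm fun _ => hb _]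
  simp only [Matrix.cons_val_zero, Matrix.cons_val_one, Matrix.cons_val]
  have e1 : ∀ a b c : ℝ, ∫ d, ψ (⌊10 * a⌋₊, ⌊10 * b⌋₊, ⌊10 * c⌋₊, ⌊10 * d⌋₊) ∂unif =
      (∑ l ∈ Finset.range 10, ψ (⌊10 * a⌋₊, ⌊10 * b⌋₊, ⌊10 * c⌋₊, l)) / 10 := fun a b c =>
    integral_unif_floor fun l => ψ (⌊10 * a⌋₊, ⌊10 * b⌋₊, ⌊10 * c⌋₊, l)
  simp only [e1]
  have e2 : ∀ a b : ℝ, ∫ c, (∑ l ∈ Finset.range 10, ψ (⌊10 * a⌋₊, ⌊10 * b⌋₊, ⌊10 * c⌋₊, l)) / 10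
      ∂unif = _ := fun a b =>
    integral_unif_floor fun k => (∑ l ∈ Finset.range 10, ψ (⌊10 * a⌋₊, ⌊10 * b⌋₊, k, l)) / 10
  simp only [e2]
  have e3 : ∀ a : ℝ, ∫ b, (∑ k ∈ Finset.range 10,
      (∑ l ∈ Finset.range 10, ψ (⌊10 * a⌋₊, ⌊10 * b⌋₊, k, l)) / 10) / 10 ∂unif = _ := fun a =>
    integral_unif_floor fun j => (∑ k ∈ Finset.range 10,
      (∑ l ∈ Finset.range 10, ψ (⌊10 * a⌋₊, j, k, l)) / 10) / 10
  simp only [e3]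
  rw [integral_unif_floor fun i => (∑ j ∈ Finset.range 10, (∑ k ∈ Finset.range 10,
      (∑ l ∈ Finset.range 10, ψ (i, j, k, l)) / 10) / 10) / 10]
  simp only [← Finset.sum_div]
  have hcount := congrArg (Nat.cast : ℕ → ℝ) code_count
  simp only [Nat.cast_sum] at hcount
  simp only [hψ, hcount]
  norm_num

end LowerBound

/-- 91/240 ≤ λ₃ ≤ 11/28, and in particular 3/8 < λ₃ < 2/5. -/
theorem lambda_three_bounds :
    (91 / 240 : ℝ) ≤ lambdaTW 3 ∧ lambdaTW 3 ≤ 11 / 28 ∧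
    (3 / 8 : ℝ) < lambdaTW 3 ∧ lambdaTW 3 < 2 / 5 := by
  have hub : ∀ r ∈ {r : ℝ | ∃ A : Set (Fin 3 → ℝ),
      MeasurableSet A ∧ A ⊆ unitCube 3 ∧ Phi 3 A = r}, r ≤ 25 / 64 := by
    rintro r ⟨A, hA, -, rfl⟩
    exact Phi_three_le_s15 hA
  have hmem : (3792 / 10000 : ℝ) ∈ {r : ℝ | ∃ A : Set (Fin 3 → ℝ),
      MeasurableSet A ∧ A ⊆ unitCube 3 ∧ Phi 3 A = r} :=
    ⟨codeSet, measurableSet_codeSet, Set.inter_subset_left, Phi_codeSet⟩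
  have hle : lambdaTW 3 ≤ 25 / 64 := csSup_le ⟨_, hmem⟩ hub
  have hge : 3792 / 10000 ≤ lambdaTW 3 := le_csSup ⟨_, hub⟩ hmem
  refine ⟨?_, ?_, ?_, ?_⟩ <;> linarith
end
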